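/- arXiv:2307.13922 — 6 statements merged into one kernel-verified Lean document; each statement's English description precedes it below -/
import Mathlib

section
/- Let G be an m×m real matrix each of whose entries g_{ij} is either 0 or 1, and let A^{ij} (1 ≤ i,j ≤ m) be real n×n matrices. Let N be the mn×mn block matrix whose (i,j) block equals A^{ij} when g_{ij} = 1 and the n×n zero matrix otherwise. Then the operator 2-norm of N satisfies ‖N‖₂ ≤ √(‖G‖₁ · ‖G‖∞) · max_{1≤i,j≤m} ‖A^{ij}‖₂. -/
open scoped BigOperators

/-- Operator `2`-norm of a real matrix: the norm of the induced linear map between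
Euclidean spaces. -/
noncomputable def opNorm2 {α β : Type*} [Fintype α] [Fintype β] [DecidableEq β]
    (M : Matrix α β ℝ) : ℝ :=
  ‖LinearMap.toContinuousLinearMap (Matrix.toEuclideanLin M)‖

/-- Operator `∞`-norm of a real matrix: maximum absolute row sum. -/
noncomputable def opNormInf {α β : Type*} [Fintype α] [Fintype β] (M : Matrix α β ℝ) : ℝ :=
  ⨆ i, ∑ j, |M i j|

/-- Operator `1`-norm of a real matrix: maximum absolute column sum. -/
noncomputable def opNorm1 {α β : Type*} [Fintype α] [Fintype β] (M : Matrix α β ℝ) : ℝ :=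
  ⨆ j, ∑ i, |M i j|

/-- The Schur test: the `2`-norm of a matrix of absolute values is controlled by its row and
column sums. -/
theorem sum_sq_sum_abs_mul_le {α β : Type*} [Fintype α] [Fintype β] (G : Matrix α β ℝ)
    (y : β → ℝ) :
    ∑ i, (∑ j, |G i j| * y j) ^ 2 ≤ opNorm1 G * opNormInf G * ∑ j, y j ^ 2 := by
  have hrow : ∀ i, ∑ j, |G i j| ≤ opNormInf G := fun i =>
    le_ciSup (f := fun i => ∑ j, |G i j|) (Set.finite_range _).bddAbove i
  have hcol : ∀ j, ∑ i, |G i j| ≤ opNorm1 G := fun j =>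
    le_ciSup (f := fun j => ∑ i, |G i j|) (Set.finite_range _).bddAbove j
  have hInf : 0 ≤ opNormInf G :=
    Real.iSup_nonneg fun i => Finset.sum_nonneg fun j _ => abs_nonneg _
  calc ∑ i, (∑ j, |G i j| * y j) ^ 2
      ≤ ∑ i, (∑ j, |G i j|) * ∑ j, |G i j| * y j ^ 2 := by
        refine Finset.sum_le_sum fun i _ => ?_
        exact Finset.sum_sq_le_sum_mul_sum_of_sq_le_mul _ (fun j _ => abs_nonneg _)
          (fun j _ => by positivity) (fun j _ => le_of_eq (by ring))
    _ ≤ ∑ i, opNormInf G * ∑ j, |G i j| * y j ^ 2 := by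
        refine Finset.sum_le_sum fun i _ => ?_
        exact mul_le_mul_of_nonneg_right (hrow i) (Finset.sum_nonneg fun j _ => by positivity)
    _ = opNormInf G * ∑ j, (∑ i, |G i j|) * y j ^ 2 := by
        rw [← Finset.mul_sum, Finset.sum_comm]
        simp only [Finset.sum_mul]
    _ ≤ opNormInf G * ∑ j, opNorm1 G * y j ^ 2 := by
        refine mul_le_mul_of_nonneg_left (Finset.sum_le_sum fun j _ => ?_) hInf
        exact mul_le_mul_of_nonneg_right (hcol j) (sq_nonneg _)
    _ = opNorm1 G * opNormInf G * ∑ j, y j ^ 2 := by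
        rw [← Finset.mul_sum]; ring

/-- The operator `2`-norm of a block matrix with blocks `G i j • A i j` whose blocks `A i j`
are bounded by `C`. -/
theorem opNorm2_block_le {ι κ α β : Type*} [Fintype ι] [Fintype κ] [Fintype α] [Fintype β]
    [DecidableEq κ] [DecidableEq β] (G : Matrix ι κ ℝ) (A : ι → κ → Matrix α β ℝ)
    (M : Matrix (ι × α) (κ × β) ℝ) (hM : ∀ i j a b, M (i, a) (j, b) = G i j * A i j a b)
    {C : ℝ} (hC : 0 ≤ C) (hA : ∀ i j, opNorm2 (A i j) ≤ C) :
    opNorm2 M ≤ Real.sqrt (opNorm1 G * opNormInf G) * C := by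
  refine ContinuousLinearMap.opNorm_le_bound _ (by positivity) fun x => ?_
  let y : κ → EuclideanSpace ℝ β := fun j => WithLp.toLp 2 fun b => x (j, b)
  let v : ι → EuclideanSpace ℝ α := fun i => ∑ j, G i j • Matrix.toEuclideanLin (A i j) (y j)
  have hv : ∀ i, ‖v i‖ ≤ C * ∑ j, |G i j| * ‖y j‖ := by
    intro i
    rw [Finset.mul_sum]
    refine norm_sum_le_of_le _ fun j _ => ?_
    have h : ‖Matrix.toEuclideanLin (A i j) (y j)‖ ≤ C * ‖y j‖ :=
      (LinearMap.toContinuousLinearMap (Matrix.toEuclideanLin (A i j))).le_of_opNorm_le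
        (hA i j) (y j)
    rw [norm_smul, Real.norm_eq_abs]
    exact (mul_le_mul_of_nonneg_left h (abs_nonneg _)).trans_eq (by ring)
  have hx : ‖x‖ ^ 2 = ∑ j, ‖y j‖ ^ 2 := by
    simp only [EuclideanSpace.norm_sq_eq, Fintype.sum_prod_type, y]
  have hMx : ‖Matrix.toEuclideanLin M x‖ ^ 2 = ∑ i, ‖v i‖ ^ 2 := by
    simp only [EuclideanSpace.norm_sq_eq, Fintype.sum_prod_type]
    refine Finset.sum_congr rfl fun i _ => Finset.sum_congr rfl fun a _ => ?_
    congr 2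
    simp [v, y, Matrix.toLpLin_apply, Matrix.mulVec, dotProduct, Fintype.sum_prod_type, hM,
      Finset.mul_sum, mul_assoc]
  have hG : 0 ≤ opNorm1 G * opNormInf G :=
    mul_nonneg (Real.iSup_nonneg fun _ => Finset.sum_nonneg fun _ _ => abs_nonneg _)
      (Real.iSup_nonneg fun _ => Finset.sum_nonneg fun _ _ => abs_nonneg _)
  change ‖Matrix.toEuclideanLin M x‖ ≤ _
  refine (sq_le_sq₀ (norm_nonneg _) (by positivity)).1 ?_
  calc ‖Matrix.toEuclideanLin M x‖ ^ 2
      ≤ ∑ i, (C * ∑ j, |G i j| * ‖y j‖) ^ 2 := by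
        rw [hMx]
        gcongr with i
        exact hv i
    _ = C ^ 2 * ∑ i, (∑ j, |G i j| * ‖y j‖) ^ 2 := by
        rw [Finset.mul_sum]
        simp only [mul_pow]
    _ ≤ C ^ 2 * (opNorm1 G * opNormInf G * ∑ j, ‖y j‖ ^ 2) := by
        gcongr
        exact sum_sq_sum_abs_mul_le G fun j => ‖y j‖
    _ = (Real.sqrt (opNorm1 G * opNormInf G) * C * ‖x‖) ^ 2 := by
        rw [mul_pow, mul_pow, Real.sq_sqrt hG, hx]; ring

/-- If `G` is an `m × m` matrix with entries in `{0,1}` and `N` is the `mn × mn` block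
matrix whose `(i,j)` block is `A^{ij}` when `G i j = 1` and `0` otherwise, then
`‖N‖₂ ≤ √(‖G‖₁ ‖G‖∞) · max_{i,j} ‖A^{ij}‖₂`. -/
theorem stmt0 {m n : ℕ} (G : Matrix (Fin m) (Fin m) ℝ)
    (hG : ∀ i j, G i j = 0 ∨ G i j = 1)
    (A : Fin m → Fin m → Matrix (Fin n) (Fin n) ℝ)
    (Nmat : Matrix (Fin m × Fin n) (Fin m × Fin n) ℝ)
    (hNmat : ∀ i j a b, Nmat (i, a) (j, b) = if G i j = 1 then A i j a b else 0) :
    opNorm2 Nmat ≤ Real.sqrt (opNorm1 G * opNormInf G) * ⨆ i, ⨆ j, opNorm2 (A i j) := by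
  refine opNorm2_block_le G A Nmat (fun i j a b => ?_)
    (Real.iSup_nonneg fun i => Real.iSup_nonneg fun j => norm_nonneg _) fun i j => ?_
  · rcases hG i j with h | h <;> simp [hNmat, h]
  · exact (le_ciSup (f := fun j => opNorm2 (A i j)) (Set.finite_range _).bddAbove j).trans
      (le_ciSup (f := fun i => ⨆ j, opNorm2 (A i j)) (Set.finite_range _).bddAbove i)
end

section
/- Let r ∈ ℝⁿ, T > 0, and let x lie in the relative interior of the probability simplex Δⁿ (i.e., Σ_i x_i = 1 and x_i > 0 for all i). Then the following are equivalent: (i) for every i, r_i − ⟨x, r⟩ + T Σ_j x_j ln(x_j / x_i) = 0; (ii) for every i, x_i = exp(r_i/T) / Σ_j exp(r_j/T). In other words, the interior rest points of the Q-Learning dynamics vector field coincide with the Boltzmann (softmax) fixed points. -/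
open scoped BigOperators

theorem sum_mul_log_div {ι : Type*} [Fintype ι] {x : ι → ℝ} (hsum : ∑ i, x i = 1)
    (hpos : ∀ i, 0 < x i) (i : ι) :
    ∑ j, x j * Real.log (x j / x i) = (∑ j, x j * Real.log (x j)) - Real.log (x i) := by
  simp_rw [Real.log_div (hpos _).ne' (hpos i).ne', mul_sub, Finset.sum_sub_distrib,
    ← Finset.sum_mul, hsum, one_mul]

/-- For `x` in the relative interior of the probability simplex, `r ∈ ℝⁿ` and `T > 0`,
the rest-point condition of the Q-learning dynamics,
`r_i − ⟨x, r⟩ + T Σ_j x_j ln(x_j/x_i) = 0` for all `i`, is equivalent to the Boltzmann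
(softmax) fixed-point condition `x_i = exp(r_i/T)/Σ_j exp(r_j/T)` for all `i`. -/
theorem stmt7 {n : ℕ} (r : Fin n → ℝ) (T : ℝ) (hT : 0 < T)
    (x : Fin n → ℝ) (hsum : (∑ i, x i) = 1) (hpos : ∀ i, 0 < x i) :
    (∀ i, r i - (∑ j, x j * r j) + T * ∑ j, x j * Real.log (x j / x i) = 0) ↔
      (∀ i, x i = Real.exp (r i / T) / ∑ j, Real.exp (r j / T)) := by
  simp_rw [sum_mul_log_div hsum hpos]
  constructor
  · intro h
    set c := (∑ j, x j * Real.log (x j)) - (∑ j, x j * r j) / T with hc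
    have hx : ∀ i, x i = Real.exp (r i / T) * Real.exp c := by
      intro i
      rw [← Real.exp_add, ← Real.exp_log (hpos i)]
      congr 1
      have hi := h i
      rw [hc]
      field_simp
      linarith
    have hZ : (∑ j, Real.exp (r j / T)) * Real.exp c = 1 := by
      rw [Finset.sum_mul, ← hsum]
      exact Finset.sum_congr rfl fun j _ => (hx j).symm
    intro i
    rw [eq_div_iff (left_ne_zero_of_mul_eq_one hZ), hx i]
    linear_combination Real.exp (r i / T) * hZ
  · intro h i
    have hZ : 0 < ∑ j, Real.exp (r j / T) :=
      Finset.sum_pos (fun j _ => Real.exp_pos _) ⟨i, Finset.mem_univ i⟩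
    set Z := ∑ j, Real.exp (r j / T)
    have hlog : ∀ j, Real.log (x j) = r j / T - Real.log Z := by
      intro j
      rw [h j, Real.log_div (Real.exp_pos _).ne' hZ.ne', Real.log_exp]
    have hH : ∑ j, x j * Real.log (x j) = (∑ j, x j * r j) / T - Real.log Z := by
      simp_rw [hlog, mul_sub, Finset.sum_sub_distrib, ← Finset.sum_mul, hsum, one_mul,
        Finset.sum_div, mul_div_assoc]
    rw [hH, hlog i]
    field_simp
    ring
end

section
/- Let G be a symmetric N×N matrix with entries in {0,1}, and for each pair (k,l) with G_{kl} = 1 let A^{kl} be a real n×n matrix. Let N̂ be the Nn×Nn block matrix whose (k,l) block is −A^{kl} when G_{kl} = 1 and the zero matrix otherwise. Then ‖(N̂ + N̂ᵀ)/2‖₂ ≤ (1/2) · δ_S · ‖G‖∞, where δ_S = max_{(k,l): G_{kl}=1} ‖A^{kl} + (A^{lk})ᵀ‖₂. -/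
open scoped BigOperators
open Matrix

lemma opNorm2_nonneg {α β : Type*} [Fintype α] [Fintype β] [DecidableEq β]
    (M : Matrix α β ℝ) : 0 ≤ opNorm2 M :=
  norm_nonneg _

lemma norm_toLp_mulVec_le_opNorm2 {α β : Type*} [Fintype α] [Fintype β] [DecidableEq β]
    (M : Matrix α β ℝ) (v : β → ℝ) :
    ‖WithLp.toLp 2 (M *ᵥ v)‖ ≤ opNorm2 M * ‖WithLp.toLp 2 v‖ :=
  (LinearMap.toContinuousLinearMap (Matrix.toEuclideanLin M)).le_opNorm (WithLp.toLp 2 v)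

lemma opNorm2_smul {α β : Type*} [Fintype α] [Fintype β] [DecidableEq β]
    (c : ℝ) (M : Matrix α β ℝ) : opNorm2 (c • M) = |c| * opNorm2 M := by
  simp [opNorm2, norm_smul]

lemma opNorm2_zero {α β : Type*} [Fintype α] [Fintype β] [DecidableEq β] :
    opNorm2 (0 : Matrix α β ℝ) = 0 := by
  simp [opNorm2]

lemma sum_abs_le_opNormInf {α β : Type*} [Fintype α] [Fintype β] (M : Matrix α β ℝ) (i : α) :
    ∑ j, |M i j| ≤ opNormInf M :=
  le_ciSup (f := fun i => ∑ j, |M i j|) (Set.finite_range _).bddAbove i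

lemma opNormInf_nonneg {α β : Type*} [Fintype α] [Fintype β] (M : Matrix α β ℝ) :
    0 ≤ opNormInf M :=
  Real.iSup_nonneg fun _ => Finset.sum_nonneg fun _ _ => abs_nonneg _

lemma norm_sq_toLp_prod {ι α : Type*} [Fintype ι] [Fintype α] (v : ι × α → ℝ) :
    ‖WithLp.toLp 2 v‖ ^ 2 = ∑ k, ‖WithLp.toLp 2 (fun a => v (k, a))‖ ^ 2 := by
  simp [EuclideanSpace.norm_sq_eq, Fintype.sum_prod_type]

/-- Schur test: a nonnegative matrix with row and column sums at most `D` is bounded by `D`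
in the Euclidean norm. -/
lemma sum_sq_mulVec_le {ι : Type*} [Fintype ι] (G : Matrix ι ι ℝ) (hG : ∀ k l, 0 ≤ G k l)
    {D : ℝ} (hrow : ∀ k, ∑ l, G k l ≤ D) (hcol : ∀ l, ∑ k, G k l ≤ D) (hD : 0 ≤ D)
    (u : ι → ℝ) : ∑ k, (∑ l, G k l * u l) ^ 2 ≤ D ^ 2 * ∑ l, u l ^ 2 := by
  calc ∑ k, (∑ l, G k l * u l) ^ 2
      ≤ ∑ k, D * ∑ l, G k l * u l ^ 2 := by
        refine Finset.sum_le_sum fun k _ => ?_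
        have h : (∑ l, G k l * u l) ^ 2 ≤ (∑ l, G k l) * ∑ l, G k l * u l ^ 2 :=
          Finset.sum_sq_le_sum_mul_sum_of_sq_le_mul _ (fun l _ => hG k l)
            (fun l _ => mul_nonneg (hG k l) (sq_nonneg _)) fun l _ => le_of_eq (by ring)
        exact h.trans (mul_le_mul_of_nonneg_right (hrow k)
          (Finset.sum_nonneg fun l _ => mul_nonneg (hG k l) (sq_nonneg _)))
    _ = D * ∑ l, (∑ k, G k l) * u l ^ 2 := by
        rw [← Finset.mul_sum, Finset.sum_comm]
        simp only [Finset.sum_mul]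
    _ ≤ D * ∑ l, D * u l ^ 2 := by
        gcongr with l
        exact hcol l
    _ = D ^ 2 * ∑ l, u l ^ 2 := by
        rw [← Finset.mul_sum]
        ring

/-- Schur test for block matrices whose blocks are bounded by the entries of `c • G`. -/
lemma opNorm2_le_of_block_le {ι α : Type*} [Fintype ι] [DecidableEq ι] [Fintype α]
    [DecidableEq α] (M : Matrix (ι × α) (ι × α) ℝ) (G : Matrix ι ι ℝ) {c D : ℝ}
    (hc : 0 ≤ c) (hD : 0 ≤ D) (hG : ∀ k l, 0 ≤ G k l)
    (hrow : ∀ k, ∑ l, G k l ≤ D) (hcol : ∀ l, ∑ k, G k l ≤ D)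
    (hM : ∀ k l, opNorm2 (M.submatrix (Prod.mk k) (Prod.mk l)) ≤ c * G k l) :
    opNorm2 M ≤ c * D := by
  refine ContinuousLinearMap.opNorm_le_bound _ (mul_nonneg hc hD) fun x => ?_
  change ‖WithLp.toLp 2 (M *ᵥ x.ofLp)‖ ≤ c * D * ‖WithLp.toLp 2 x.ofLp‖
  generalize x.ofLp = v
  refine le_of_sq_le_sq ?_ (by positivity)
  rw [mul_pow, norm_sq_toLp_prod, norm_sq_toLp_prod v]
  set u : ι → ℝ := fun l => ‖WithLp.toLp 2 (fun a => v (l, a))‖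
  have hblock : ∀ k, ‖WithLp.toLp 2 (fun a => (M *ᵥ v) (k, a))‖ ≤ c * ∑ l, G k l * u l := by
    intro k
    have hsum : WithLp.toLp 2 (fun a => (M *ᵥ v) (k, a)) = ∑ l, WithLp.toLp 2
        (M.submatrix (Prod.mk k) (Prod.mk l) *ᵥ fun a => v (l, a)) := by
      ext a
      simp [Matrix.mulVec, dotProduct, Fintype.sum_prod_type]
    rw [hsum, Finset.mul_sum]
    refine norm_sum_le_of_le _ fun l _ => ?_
    rw [← mul_assoc]
    exact (norm_toLp_mulVec_le_opNorm2 _ _).trans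
      (mul_le_mul_of_nonneg_right (hM k l) (norm_nonneg _))
  calc ∑ k, ‖WithLp.toLp 2 (fun a => (M *ᵥ v) (k, a))‖ ^ 2
      ≤ ∑ k, (c * ∑ l, G k l * u l) ^ 2 := by
        gcongr with k
        exact hblock k
    _ = c ^ 2 * ∑ k, (∑ l, G k l * u l) ^ 2 := by
        rw [Finset.mul_sum]
        simp only [mul_pow]
    _ ≤ c ^ 2 * (D ^ 2 * ∑ l, u l ^ 2) := by
        gcongr
        exact sum_sq_mulVec_le G hG hrow hcol hD u
    _ = (c * D) ^ 2 * ∑ l, u l ^ 2 := by ring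

/-- If `G` is a symmetric `{0,1}`-adjacency matrix and `N̂` is the block matrix whose
`(k,l)` block is `−A^{kl}` when `G k l = 1` and `0` otherwise, then
`‖(N̂ + N̂ᵀ)/2‖₂ ≤ (1/2) δ_S ‖G‖∞`, where
`δ_S = max_{(k,l): G_{kl}=1} ‖A^{kl} + (A^{lk})ᵀ‖₂` is the interaction coefficient. -/
theorem stmt8 {N n : ℕ} (G : Matrix (Fin N) (Fin N) ℝ) (hGsym : G.IsSymm)
    (hG01 : ∀ k l, G k l = 0 ∨ G k l = 1)
    (A : Fin N → Fin N → Matrix (Fin n) (Fin n) ℝ)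
    (Nhat : Matrix (Fin N × Fin n) (Fin N × Fin n) ℝ)
    (hNhat : ∀ k l a b, Nhat (k, a) (l, b) = if G k l = 1 then -(A k l a b) else 0)
    (δS : ℝ)
    (hδS : δS = ⨆ p : {q : Fin N × Fin N // G q.1 q.2 = 1},
      opNorm2 (A p.1.1 p.1.2 + (A p.1.2 p.1.1)ᵀ)) :
    opNorm2 ((1 / 2 : ℝ) • (Nhat + Nhatᵀ)) ≤ (1 / 2) * δS * opNormInf G := by
  have hG : ∀ k l, 0 ≤ G k l := fun k l => by
    rcases hG01 k l with h | h <;> simp [h]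
  have hrow : ∀ k, ∑ l, G k l ≤ opNormInf G := fun k =>
    (Finset.sum_le_sum fun l _ => le_abs_self (G k l)).trans (sum_abs_le_opNormInf G k)
  have hcol : ∀ l, ∑ k, G k l ≤ opNormInf G := fun l => by
    simpa only [hGsym.apply] using hrow l
  have hδ : 0 ≤ δS := hδS ▸ Real.iSup_nonneg fun _ => opNorm2_nonneg _
  refine opNorm2_le_of_block_le _ G (by positivity) (opNormInf_nonneg G) hG hrow hcol
    fun k l => ?_
  have hsym : G l k = G k l := hGsym.apply k l
  rcases hG01 k l with h | h
  · have hzero : ((1 / 2 : ℝ) • (Nhat + Nhatᵀ)).submatrix (Prod.mk k) (Prod.mk l) = 0 := by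
      ext a b
      simp [hNhat, hsym, h]
    rw [hzero, opNorm2_zero, h, mul_zero]
  · have hblock : ((1 / 2 : ℝ) • (Nhat + Nhatᵀ)).submatrix (Prod.mk k) (Prod.mk l) =
        (-(1 / 2) : ℝ) • (A k l + (A l k)ᵀ) := by
      ext a b
      simp [hNhat, hsym, h]
      ring
    have hle : opNorm2 (A k l + (A l k)ᵀ) ≤ δS := by
      rw [hδS]
      exact le_ciSup (f := fun p : {q : Fin N × Fin N // G q.1 q.2 = 1} =>
        opNorm2 (A p.1.1 p.1.2 + (A p.1.2 p.1.1)ᵀ)) (Set.finite_range _).bddAbove ⟨(k, l), h⟩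
    rw [hblock, opNorm2_smul, h, mul_one, abs_neg, abs_of_pos (by norm_num)]
    gcongr
end

section
/- Consider a network game with N agents on a symmetric adjacency matrix G ∈ {0,1}^{N×N} with zero diagonal, where each agent has n actions and each edge (k,l) with G_{kl}=1 carries payoff matrices A^{kl}, A^{lk} ∈ ℝ^{n×n}. Fix exploration rates T_1,…,T_N > 0 and define, on the product of relative interiors of the simplices, the perturbed pseudo-gradient F with blocks F_k(x) = −Σ_{l} G_{kl} A^{kl} x_l + T_k (ln x_k + 𝟙), where ln x_k is applied coordinatewise and 𝟙 is the all-ones vector. If T_k > (1/2) δ_S ‖G‖∞ for all k, where δ_S = max_{(k,l): G_{kl}=1} ‖A^{kl} + (A^{lk})ᵀ‖₂, then F is strongly monotone on the product of relative interiors of the simplices with constant (min_k T_k) − (1/2) δ_S ‖G‖∞ > 0: for all such x, y, ⟨F(x) − F(y), x − y⟩ ≥ ((min_k T_k) − (1/2) δ_S ‖G‖∞) ‖x − y‖₂². -/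
open scoped BigOperators
open Matrix

/-- Bound on a bilinear form by the operator `2`-norm of its matrix. -/
lemma dotProduct_mulVec_le_opNorm2 {α β : Type*} [Fintype α] [Fintype β] [DecidableEq β]
    (M : Matrix α β ℝ) (u : α → ℝ) (v : β → ℝ) :
    ∑ i, u i * M.mulVec v i ≤ opNorm2 M * ((∑ i, u i ^ 2 + ∑ j, v j ^ 2) / 2) := by
  have hinner : ∑ i, u i * M.mulVec v i =
      inner ℝ (WithLp.toLp 2 u) (Matrix.toEuclideanLin M (WithLp.toLp 2 v)) := by
    simp [PiLp.inner_apply, mul_comm]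
  have hu : ‖WithLp.toLp 2 u‖ ^ 2 = ∑ i, u i ^ 2 := by simp [EuclideanSpace.norm_sq_eq]
  have hv : ‖WithLp.toLp 2 v‖ ^ 2 = ∑ j, v j ^ 2 := by simp [EuclideanSpace.norm_sq_eq]
  have hM : ‖Matrix.toEuclideanLin M (WithLp.toLp 2 v)‖ ≤ opNorm2 M * ‖WithLp.toLp 2 v‖ :=
    (LinearMap.toContinuousLinearMap (Matrix.toEuclideanLin M)).le_opNorm (WithLp.toLp 2 v)
  have hM0 : 0 ≤ opNorm2 M := norm_nonneg _
  rw [hinner, ← hu, ← hv]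
  calc _ ≤ ‖WithLp.toLp 2 u‖ * ‖Matrix.toEuclideanLin M (WithLp.toLp 2 v)‖ :=
        real_inner_le_norm _ _
    _ ≤ ‖WithLp.toLp 2 u‖ * (opNorm2 M * ‖WithLp.toLp 2 v‖) := by gcongr
    _ = opNorm2 M * (‖WithLp.toLp 2 u‖ * ‖WithLp.toLp 2 v‖) := by ring
    _ ≤ _ := by
        gcongr
        linarith [two_mul_le_add_sq ‖WithLp.toLp 2 u‖ ‖WithLp.toLp 2 v‖]

/-- The logarithm is strongly monotone with constant `1` on `(0, 1]`. -/
lemma sq_sub_le_log_sub_mul_sub {a b : ℝ} (ha : 0 < a) (hb : 0 < b) (ha1 : a ≤ 1) (hb1 : b ≤ 1) :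
    (a - b) ^ 2 ≤ (Real.log a - Real.log b) * (a - b) := by
  wlog hab : b ≤ a generalizing a b
  · linarith [this hb ha hb1 ha1 (le_of_not_ge hab)]
  have hlog : a - b ≤ Real.log a - Real.log b := by
    have h := Real.log_le_sub_one_of_pos (div_pos hb ha)
    rw [Real.log_div hb.ne' ha.ne'] at h
    have hdiv : a - b ≤ 1 - b / a := by
      rw [one_sub_div ha.ne', le_div_iff₀ ha]
      nlinarith
    linarith
  nlinarith

/-- A quadratic form of bilinear edge interactions on a symmetric nonnegative weighted graph is
controlled by the interaction bound on the edges and the maximal weighted degree. -/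
lemma sum_interaction_le {N n : ℕ} {G : Matrix (Fin N) (Fin N) ℝ} (hGsym : G.IsSymm)
    (hG0 : ∀ k l, 0 ≤ G k l) (A : Fin N → Fin N → Matrix (Fin n) (Fin n) ℝ)
    {δ : ℝ} (hδ0 : 0 ≤ δ)
    (hδ : ∀ k l, G k l ≠ 0 → opNorm2 (A k l + (A l k)ᵀ) ≤ δ) (d : Fin N → Fin n → ℝ) :
    ∑ k, ∑ l, G k l * ∑ i, d k i * (A k l).mulVec (d l) i ≤
      (1 / 2) * δ * opNormInf G * ∑ k, ∑ i, d k i ^ 2 := by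
  set s : Fin N → ℝ := fun k => ∑ i, d k i ^ 2
  have hs : ∀ k, 0 ≤ s k := fun k => Finset.sum_nonneg fun i _ => sq_nonneg _
  set q : Fin N → Fin N → ℝ := fun k l => ∑ i, d k i * (A k l).mulVec (d l) i
  have hswap : ∑ k, ∑ l, G k l * q k l = ∑ k, ∑ l, G k l * q l k := by
    rw [Finset.sum_comm]
    refine Finset.sum_congr rfl fun k _ => Finset.sum_congr rfl fun l _ => ?_
    rw [hGsym.apply]
  have hq : ∀ k l, q k l + q l k = ∑ i, d k i * (A k l + (A l k)ᵀ).mulVec (d l) i := by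
    intro k l
    have htr : q l k = ∑ i, d k i * ((A l k)ᵀ).mulVec (d l) i := by
      change d l ⬝ᵥ (A l k).mulVec (d k) = d k ⬝ᵥ ((A l k)ᵀ).mulVec (d l)
      rw [Matrix.dotProduct_mulVec, Matrix.mulVec_transpose, dotProduct_comm]
    rw [htr, ← Finset.sum_add_distrib]
    simp [Matrix.add_mulVec, mul_add]
  have hedge : ∀ k l, G k l * (q k l + q l k) ≤ G k l * (δ * ((s k + s l) / 2)) := by
    intro k l
    by_cases h : G k l = 0
    · simp [h]
    refine mul_le_mul_of_nonneg_left ?_ (hG0 k l)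
    rw [hq]
    refine (dotProduct_mulVec_le_opNorm2 _ _ _).trans ?_
    exact mul_le_mul_of_nonneg_right (hδ k l h) (by linarith [hs k, hs l])
  have hsum : ∑ k, ∑ l, G k l * (δ * ((s k + s l) / 2)) = δ * ∑ k, (∑ l, G k l) * s k := by
    have h₁ : ∑ k, ∑ l, G k l * s l = ∑ k, ∑ l, G k l * s k := by
      rw [Finset.sum_comm]
      refine Finset.sum_congr rfl fun k _ => Finset.sum_congr rfl fun l _ => ?_
      rw [hGsym.apply]
    calc _ = δ / 2 * (∑ k, ∑ l, G k l * s k + ∑ k, ∑ l, G k l * s l) := by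
          simp only [← Finset.sum_add_distrib, Finset.mul_sum]
          refine Finset.sum_congr rfl fun k _ => Finset.sum_congr rfl fun l _ => ?_
          ring
      _ = δ * ∑ k, (∑ l, G k l) * s k := by
          rw [h₁]
          simp only [Finset.sum_mul]
          ring
  have hdeg : ∑ k, (∑ l, G k l) * s k ≤ opNormInf G * ∑ k, s k := by
    rw [Finset.mul_sum]
    refine Finset.sum_le_sum fun k _ => mul_le_mul_of_nonneg_right ?_ (hs k)
    exact (Finset.sum_le_sum fun l _ => le_abs_self _).trans (sum_abs_le_opNormInf G k)
  have htwo : 2 * ∑ k, ∑ l, G k l * q k l ≤ δ * ∑ k, (∑ l, G k l) * s k := by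
    rw [← hsum, two_mul]
    nth_rewrite 2 [hswap]
    simp only [← Finset.sum_add_distrib, ← mul_add]
    exact Finset.sum_le_sum fun k _ => Finset.sum_le_sum fun l _ => hedge k l
  linarith [mul_le_mul_of_nonneg_left hdeg hδ0]

/-- In a network game with adjacency matrix `G`, payoff matrices `A^{kl}` and exploration
rates `T_k > (1/2) δ_S ‖G‖∞`, the entropy-perturbed pseudo-gradient
`F_k(x) = −Σ_l G_{kl} A^{kl} x_l + T_k (ln x_k + 𝟙)` is strongly monotone on the product of
relative interiors of the simplices with constant `(min_k T_k) − (1/2) δ_S ‖G‖∞ > 0`. -/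
theorem stmt12 {N n : ℕ} (hN : 0 < N)
    (G : Matrix (Fin N) (Fin N) ℝ) (hGsym : G.IsSymm)
    (hG01 : ∀ k l, G k l = 0 ∨ G k l = 1) (hGdiag : ∀ k, G k k = 0)
    (A : Fin N → Fin N → Matrix (Fin n) (Fin n) ℝ)
    (T : Fin N → ℝ) (hT : ∀ k, 0 < T k)
    (δS : ℝ)
    (hδS : δS = ⨆ p : {q : Fin N × Fin N // G q.1 q.2 = 1},
      opNorm2 (A p.1.1 p.1.2 + (A p.1.2 p.1.1)ᵀ))
    (hTbig : ∀ k, (1 / 2) * δS * opNormInf G < T k)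
    (F : (Fin N → Fin n → ℝ) → Fin N → Fin n → ℝ)
    (hF : ∀ x k i, F x k i =
      -(∑ l, G k l * (A k l).mulVec (x l) i) + T k * (Real.log (x k i) + 1)) :
    0 < (⨅ k, T k) - (1 / 2) * δS * opNormInf G ∧
      ∀ x y : Fin N → Fin n → ℝ,
        (∀ k, (∑ i, x k i) = 1 ∧ ∀ i, 0 < x k i) →
        (∀ k, (∑ i, y k i) = 1 ∧ ∀ i, 0 < y k i) →
        ((⨅ k, T k) - (1 / 2) * δS * opNormInf G) * ∑ k, ∑ i, (x k i - y k i) ^ 2 ≤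
          ∑ k, ∑ i, (F x k i - F y k i) * (x k i - y k i) := by
  have : Nonempty (Fin N) := ⟨⟨0, hN⟩⟩
  refine ⟨?_, fun x y hx hy => ?_⟩
  · obtain ⟨k, hk⟩ := exists_eq_ciInf_of_finite (f := T)
    rw [← hk]
    linarith [hTbig k]
  have hle1 : ∀ z : Fin N → Fin n → ℝ, (∀ k, (∑ i, z k i) = 1 ∧ ∀ i, 0 < z k i) →
      ∀ k i, z k i ≤ 1 := fun z hz k i =>
    (hz k).1 ▸ Finset.single_le_sum (f := z k) (fun j _ => ((hz k).2 j).le) (Finset.mem_univ i)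
  have hG0 : ∀ k l, 0 ≤ G k l := fun k l => by
    rcases hG01 k l with h | h <;> simp [h]
  have hδ0 : 0 ≤ δS := hδS ▸ Real.iSup_nonneg fun p => norm_nonneg _
  have hδ : ∀ k l, G k l ≠ 0 → opNorm2 (A k l + (A l k)ᵀ) ≤ δS := by
    intro k l h
    rw [hδS]
    exact le_ciSup (f := fun p : {q : Fin N × Fin N // G q.1 q.2 = 1} =>
      opNorm2 (A p.1.1 p.1.2 + (A p.1.2 p.1.1)ᵀ)) (Set.finite_range _).bddAbove
      ⟨(k, l), (hG01 k l).resolve_left h⟩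
  have hinteraction := sum_interaction_le hGsym hG0 A hδ0 hδ (x - y)
  have hentropy : (⨅ k, T k) * ∑ k, ∑ i, (x k i - y k i) ^ 2 ≤
      ∑ k, ∑ i, T k * ((Real.log (x k i) - Real.log (y k i)) * (x k i - y k i)) := by
    simp only [Finset.mul_sum]
    refine Finset.sum_le_sum fun k _ => Finset.sum_le_sum fun i _ => ?_
    exact mul_le_mul (ciInf_le (Set.finite_range T).bddBelow k)
      (sq_sub_le_log_sub_mul_sub ((hx k).2 i) ((hy k).2 i) (hle1 x hx k i) (hle1 y hy k i))
      (sq_nonneg _) (hT k).le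
  have hsplit : ∑ k, ∑ i, (F x k i - F y k i) * (x k i - y k i) =
      ∑ k, ∑ i, T k * ((Real.log (x k i) - Real.log (y k i)) * (x k i - y k i)) -
        ∑ k, ∑ l, G k l * ∑ i, (x - y) k i * (A k l).mulVec ((x - y) l) i := by
    rw [← Finset.sum_sub_distrib]
    refine Finset.sum_congr rfl fun k _ => ?_
    simp only [Finset.mul_sum]
    rw [Finset.sum_comm, ← Finset.sum_sub_distrib]
    refine Finset.sum_congr rfl fun i _ => ?_
    have hA : ∑ l, G k l * ((x - y) k i * (A k l).mulVec ((x - y) l) i) =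
        (∑ l, G k l * (A k l).mulVec (x l) i - ∑ l, G k l * (A k l).mulVec (y l) i) *
          (x k i - y k i) := by
      rw [← Finset.sum_sub_distrib, Finset.sum_mul]
      refine Finset.sum_congr rfl fun l _ => ?_
      simp only [Pi.sub_apply, Matrix.mulVec_sub]
      ring
    rw [hA, hF, hF]
    ring
  simp only [Pi.sub_apply] at hinteraction hsplit
  rw [hsplit, sub_mul]
  linarith
end

section
/- (Uniqueness of the Quantal Response Equilibrium, equilibrium part of Theorem 1) Consider a network game with N agents on a symmetric adjacency matrix G ∈ {0,1}^{N×N} with zero diagonal, n actions per agent, payoff matrices A^{kl} on each edge, and exploration rates T_1,…,T_N > 0. Define the reward of agent k at joint strategy x by r_k(x) = Σ_l G_{kl} A^{kl} x_l ∈ ℝⁿ. If T_k > (1/2) δ_S ‖G‖∞ for all k, where δ_S = max_{(k,l): G_{kl}=1} ‖A^{kl} + (A^{lk})ᵀ‖₂, then there exists exactly one point x̄ ∈ (Δⁿ)^N satisfying, for every agent k and every action i, x̄_{ki} = exp(r_{ki}(x̄)/T_k) / Σ_{j=1}^n exp(r_{kj}(x̄)/T_k); i.e., the game has a unique Quantal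 Response Equilibrium. -/
open scoped BigOperators
open Matrix

section VariationalInequality

variable {E : Type*} [NormedAddCommGroup E] [InnerProductSpace ℝ E]

/-- The variational inequalities characterizing metric projections onto a convex set force them
to be nonexpansive. -/
lemma norm_sub_le_of_inner_projection {u v p q : E}
    (hp : inner ℝ (u - p) (q - p) ≤ 0) (hq : inner ℝ (v - q) (p - q) ≤ 0) :
    ‖p - q‖ ≤ ‖u - v‖ := by
  have h : ‖p - q‖ ^ 2 ≤ inner ℝ (u - v) (p - q) := by
    have e : inner ℝ (u - v) (p - q) =
        ‖p - q‖ ^ 2 - inner ℝ (u - p) (q - p) - inner ℝ (v - q) (p - q) := by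
      rw [← real_inner_self_eq_norm_sq]
      simp only [inner_sub_left, inner_sub_right]
      ring
    linarith
  have h2 := h.trans (real_inner_le_norm (u - v) (p - q))
  rcases (norm_nonneg (p - q)).eq_or_lt with h0 | h0
  · rw [← h0]; positivity
  · exact le_of_mul_le_mul_right (by linarith [sq ‖p - q‖]) h0

/-- A strongly monotone Lipschitz operator on a nonempty closed convex set solves its
variational inequality. -/
lemma exists_variational_inequality_solution [CompleteSpace E] {K : Set E}
    (hne : K.Nonempty) (hcl : IsClosed K) (hconv : Convex ℝ K) (F : E → E) {m L : ℝ}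
    (hm : 0 < m) (hL : 0 < L)
    (hmono : ∀ x ∈ K, ∀ y ∈ K, m * ‖x - y‖ ^ 2 ≤ inner ℝ (F x - F y) (x - y))
    (hlip : ∀ x ∈ K, ∀ y ∈ K, ‖F x - F y‖ ≤ L * ‖x - y‖) :
    ∃ x ∈ K, ∀ y ∈ K, 0 ≤ inner ℝ (F x) (y - x) := by
  have hproj : ∀ u : E, ∃ p : K, ∀ w ∈ K, inner ℝ (u - p) (w - p) ≤ 0 := by
    intro u
    obtain ⟨p, hp, h⟩ := exists_norm_eq_iInf_of_complete_convex hne hcl.isComplete hconv u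
    exact ⟨⟨p, hp⟩, (norm_eq_iInf_iff_real_inner_le_zero hconv hp).1 h⟩
  choose P hP using hproj
  set η := m / L ^ 2 with hη
  have hη0 : 0 < η := by positivity
  have : CompleteSpace K := hcl.completeSpace_coe
  have : Nonempty K := hne.to_subtype
  set q := Real.sqrt (1 - m ^ 2 / L ^ 2) with hq
  have hq1 : q < 1 := by
    rw [hq, Real.sqrt_lt' one_pos]
    have : 0 < m ^ 2 / L ^ 2 := by positivity
    linarith
  let g : K → K := fun x => P (x - η • F x)
  have hg : ContractingWith q.toNNReal g := by
    refine ⟨by simpa using hq1, LipschitzWith.of_dist_le_mul fun x y => ?_⟩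
    rw [Subtype.dist_eq, Subtype.dist_eq, dist_eq_norm, dist_eq_norm,
      Real.coe_toNNReal _ (Real.sqrt_nonneg _)]
    refine (norm_sub_le_of_inner_projection (hP _ _ (P _).2) (hP _ _ (P _).2)).trans ?_
    have hsq : ‖(x : E) - η • F x - (y - η • F y)‖ ^ 2 ≤
        (1 - m ^ 2 / L ^ 2) * ‖(x : E) - y‖ ^ 2 := by
      have e : (x : E) - η • F x - (y - η • F y) = (x - y) - η • (F x - F y) := by
        rw [smul_sub]; abel
      rw [e, norm_sub_sq_real, inner_smul_right, norm_smul, mul_pow, real_inner_comm,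
        Real.norm_eq_abs, sq_abs]
      have h1 := mul_le_mul_of_nonneg_left (hmono x x.2 y y.2) hη0.le
      have h2 := mul_le_mul_of_nonneg_left
        (pow_le_pow_left₀ (norm_nonneg _) (hlip x x.2 y y.2) 2) (sq_nonneg η)
      have e2 : (1 - m ^ 2 / L ^ 2) * ‖(x : E) - y‖ ^ 2 = ‖(x : E) - y‖ ^ 2
          - 2 * (η * (m * ‖(x : E) - y‖ ^ 2)) + η ^ 2 * (L * ‖(x : E) - y‖) ^ 2 := by
        rw [hη]; field_simp; ring
      linarith
    calc _ = Real.sqrt (‖(x : E) - η • F x - (y - η • F y)‖ ^ 2) :=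
          (Real.sqrt_sq (norm_nonneg _)).symm
      _ ≤ Real.sqrt ((1 - m ^ 2 / L ^ 2) * ‖(x : E) - y‖ ^ 2) := Real.sqrt_le_sqrt hsq
      _ = _ := by rw [Real.sqrt_mul' _ (sq_nonneg _), Real.sqrt_sq (norm_nonneg _)]
  have hfix : P ((hg.fixedPoint g : K) - η • F (hg.fixedPoint g : K)) = hg.fixedPoint g :=
    hg.fixedPoint_isFixedPt
  refine ⟨_, (hg.fixedPoint g).2, fun y hy => ?_⟩
  have h := hP ((hg.fixedPoint g : K) - η • F (hg.fixedPoint g : K)) y hy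
  rw [hfix, sub_sub_cancel_left, inner_neg_left, inner_smul_left] at h
  simp only [conj_trivial] at h
  exact nonneg_of_mul_nonneg_right (by linarith) hη0

end VariationalInequality

lemma Real.sq_sub_le_log_sub_log_mul {a b : ℝ} (ha : 0 < a) (ha1 : a ≤ 1) (hb : 0 < b)
    (hb1 : b ≤ 1) : (a - b) ^ 2 ≤ (Real.log a - Real.log b) * (a - b) := by
  have key : ∀ {a b : ℝ}, 0 < a → a ≤ 1 → 0 < b → b ≤ a →
      (a - b) ^ 2 ≤ (Real.log a - Real.log b) * (a - b) := by
    intro a b ha ha1 hb hba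
    have h := Real.one_sub_inv_le_log_of_pos (div_pos ha hb)
    rw [Real.log_div ha.ne' hb.ne', inv_div] at h
    have h2 : a - b ≤ 1 - b / a := by
      rw [one_sub_div ha.ne', le_div_iff₀ ha]
      nlinarith
    rw [sq]
    exact mul_le_mul_of_nonneg_right (h2.trans h) (by linarith)
  rcases le_total b a with h | h
  · exact key ha ha1 hb h
  · have := key hb hb1 ha h
    nlinarith

lemma Real.abs_log_sub_log_le {ε a b : ℝ} (hε : 0 < ε) (ha : ε ≤ a) (hb : ε ≤ b) :
    |Real.log a - Real.log b| ≤ ε⁻¹ * |a - b| := by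
  have key : ∀ {a b : ℝ}, ε ≤ a → ε ≤ b → Real.log a - Real.log b ≤ ε⁻¹ * |a - b| := by
    intro a b ha hb
    have ha0 := hε.trans_le ha
    have hb0 := hε.trans_le hb
    have h := Real.log_le_sub_one_of_pos (div_pos ha0 hb0)
    rw [Real.log_div ha0.ne' hb0.ne', div_sub_one hb0.ne'] at h
    calc _ ≤ (a - b) / b := h
      _ ≤ |a - b| / b := by gcongr; exact le_abs_self _
      _ ≤ |a - b| / ε := by gcongr
      _ = _ := by rw [div_eq_inv_mul]
  refine abs_le.2 ⟨?_, key ha hb⟩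
  have := key hb ha
  rw [abs_sub_comm] at this
  linarith

lemma bilin_le_opNorm2 {n : ℕ} (M : Matrix (Fin n) (Fin n) ℝ) (u v : Fin n → ℝ) :
    u ⬝ᵥ M *ᵥ v ≤ opNorm2 M * (‖WithLp.toLp 2 u‖ * ‖WithLp.toLp 2 v‖) := by
  have h1 := real_inner_le_norm (WithLp.toLp 2 u)
    (LinearMap.toContinuousLinearMap (Matrix.toEuclideanLin M) (WithLp.toLp 2 v))
  have h2 := (LinearMap.toContinuousLinearMap (Matrix.toEuclideanLin M)).le_opNorm
    (WithLp.toLp 2 v)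
  have h3 : inner ℝ (WithLp.toLp 2 u)
      (LinearMap.toContinuousLinearMap (Matrix.toEuclideanLin M) (WithLp.toLp 2 v)) =
      u ⬝ᵥ M *ᵥ v := by
    simp [PiLp.inner_apply, dotProduct, Matrix.toLpLin_apply, mul_comm]
  rw [← h3, opNorm2]
  refine h1.trans ?_
  calc _ ≤ ‖WithLp.toLp 2 u‖ * _ := mul_le_mul_of_nonneg_left h2 (norm_nonneg _)
    _ = _ := by ring

section Game

variable {N n : ℕ}

/-- Reward of action `i` for agent `k` at the joint strategy `x`. -/
def reward (G : Matrix (Fin N) (Fin N) ℝ) (A : Fin N → Fin N → Matrix (Fin n) (Fin n) ℝ)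
    (x : Fin N → Fin n → ℝ) (k : Fin N) (i : Fin n) : ℝ :=
  ∑ l, G k l * (A k l).mulVec (x l) i

lemma reward_sub (G : Matrix (Fin N) (Fin N) ℝ)
    (A : Fin N → Fin N → Matrix (Fin n) (Fin n) ℝ) (x y : Fin N → Fin n → ℝ) (k : Fin N)
    (i : Fin n) : reward G A (x - y) k i = reward G A x k i - reward G A y k i := by
  simp [reward, Matrix.mulVec_sub, mul_sub]

lemma exists_abs_reward_le (G : Matrix (Fin N) (Fin N) ℝ)
    (A : Fin N → Fin N → Matrix (Fin n) (Fin n) ℝ) :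
    ∃ B : ℝ, 0 < B ∧ ∀ (x : Fin N → Fin n → ℝ) (C : ℝ), (∀ k i, |x k i| ≤ C) →
      ∀ k i, |reward G A x k i| ≤ B * C := by
  obtain ⟨B, hB⟩ := Finite.exists_le
    (fun p : Fin N × Fin n => ∑ l, |G p.1 l| * ∑ j, |A p.1 l p.2 j|)
  refine ⟨max B 1, by positivity, fun x C hx k i => ?_⟩
  have hC : 0 ≤ C := (abs_nonneg _).trans (hx k i)
  calc |reward G A x k i| ≤ ∑ l, |G k l| * ∑ j, |A k l i j| * C := by
        refine (Finset.abs_sum_le_sum_abs _ _).trans (Finset.sum_le_sum fun l _ => ?_)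
        rw [abs_mul]
        refine mul_le_mul_of_nonneg_left ?_ (abs_nonneg _)
        rw [Matrix.mulVec, dotProduct]
        refine (Finset.abs_sum_le_sum_abs _ _).trans (Finset.sum_le_sum fun j _ => ?_)
        rw [abs_mul]
        exact mul_le_mul_of_nonneg_left (hx l j) (abs_nonneg _)
    _ = (∑ l, |G k l| * ∑ j, |A k l i j|) * C := by
        simp only [Finset.sum_mul, mul_assoc]
    _ ≤ max B 1 * C := mul_le_mul_of_nonneg_right ((hB (k, i)).trans (le_max_left _ _)) hC

/-- The interaction part of the game is bounded by half the interaction coefficient times the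
`∞`-norm of the adjacency matrix. -/
lemma sum_mul_reward_le (G : Matrix (Fin N) (Fin N) ℝ) (hGsym : G.IsSymm)
    (hG01 : ∀ k l, G k l = 0 ∨ G k l = 1)
    (A : Fin N → Fin N → Matrix (Fin n) (Fin n) ℝ) (d : Fin N → Fin n → ℝ) :
    ∑ k, ∑ i, d k i * reward G A d k i ≤
      (1 / 2) * (⨆ p : {q : Fin N × Fin N // G q.1 q.2 = 1},
        opNorm2 (A p.1.1 p.1.2 + (A p.1.2 p.1.1)ᵀ)) * opNormInf G * ∑ k, ∑ i, d k i ^ 2 := by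
  set δ := ⨆ p : {q : Fin N × Fin N // G q.1 q.2 = 1},
        opNorm2 (A p.1.1 p.1.2 + (A p.1.2 p.1.1)ᵀ) with hδ
  have hδ0 : 0 ≤ δ := Real.iSup_nonneg fun p => norm_nonneg _
  set a : Fin N → ℝ := fun k => ‖WithLp.toLp 2 (d k)‖ with ha
  have hasq : ∀ k, a k ^ 2 = ∑ i, d k i ^ 2 := fun k => by
    simp [ha, EuclideanSpace.norm_sq_eq]
  have hG0 : ∀ k l, 0 ≤ G k l := fun k l => by rcases hG01 k l with h | h <;> simp [h]
  have hS : ∑ k, ∑ i, d k i * reward G A d k i =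
      ∑ k, ∑ l, G k l * (d k ⬝ᵥ A k l *ᵥ d l) := by
    refine Finset.sum_congr rfl fun k _ => ?_
    simp only [reward, Finset.mul_sum, dotProduct]
    rw [Finset.sum_comm]
    refine Finset.sum_congr rfl fun l _ => Finset.sum_congr rfl fun i _ => ?_
    ring
  have hS' : ∑ k, ∑ l, G k l * (d k ⬝ᵥ A k l *ᵥ d l) =
      ∑ k, ∑ l, G k l * (d k ⬝ᵥ (A l k)ᵀ *ᵥ d l) := by
    rw [Finset.sum_comm]
    refine Finset.sum_congr rfl fun k _ => Finset.sum_congr rfl fun l _ => ?_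
    rw [hGsym.apply, Matrix.mulVec_transpose, dotProduct_comm (d k), Matrix.dotProduct_mulVec]
  have hsum : 2 * ∑ k, ∑ l, G k l * (d k ⬝ᵥ A k l *ᵥ d l) =
      ∑ k, ∑ l, G k l * (d k ⬝ᵥ (A k l + (A l k)ᵀ) *ᵥ d l) := by
    rw [two_mul]
    nth_rewrite 2 [hS']
    simp only [← Finset.sum_add_distrib, Matrix.add_mulVec, dotProduct_add, mul_add]
  have hterm : ∀ k l, G k l * (d k ⬝ᵥ (A k l + (A l k)ᵀ) *ᵥ d l) ≤
      δ * (G k l * (a k ^ 2 + a l ^ 2) / 2) := by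
    intro k l
    rcases hG01 k l with h | h
    · simp [h]
    · have hle : opNorm2 (A k l + (A l k)ᵀ) ≤ δ :=
        le_ciSup (f := fun p : {q : Fin N × Fin N // G q.1 q.2 = 1} =>
          opNorm2 (A p.1.1 p.1.2 + (A p.1.2 p.1.1)ᵀ)) (Set.finite_range _).bddAbove ⟨(k, l), h⟩
      rw [h, one_mul, one_mul]
      refine (bilin_le_opNorm2 _ _ _).trans ?_
      have : a k * a l ≤ (a k ^ 2 + a l ^ 2) / 2 := by nlinarith [sq_nonneg (a k - a l)]
      exact mul_le_mul hle this (by positivity) hδ0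
  have hrow : ∀ k, ∑ l, G k l ≤ opNormInf G := fun k =>
    (Finset.sum_le_sum fun l _ => le_abs_self _).trans
      (le_ciSup (f := fun i => ∑ j, |G i j|) (Set.finite_range _).bddAbove k)
  have hsplit : ∑ k, ∑ l, G k l * (a k ^ 2 + a l ^ 2) / 2 = ∑ k, (∑ l, G k l) * a k ^ 2 := by
    have e : ∑ k, ∑ l, G k l * a l ^ 2 = ∑ k, ∑ l, G k l * a k ^ 2 := by
      rw [Finset.sum_comm]
      refine Finset.sum_congr rfl fun k _ => Finset.sum_congr rfl fun l _ => ?_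
      rw [hGsym.apply]
    simp only [← Finset.sum_div, mul_add, Finset.sum_add_distrib, Finset.sum_mul, e]
    ring
  have hfin : ∑ k, (∑ l, G k l) * a k ^ 2 ≤ opNormInf G * ∑ k, ∑ i, d k i ^ 2 := by
    rw [Finset.mul_sum]
    refine Finset.sum_le_sum fun k _ => ?_
    rw [← hasq]
    exact mul_le_mul_of_nonneg_right (hrow k) (sq_nonneg _)
  have hmain : 2 * ∑ k, ∑ l, G k l * (d k ⬝ᵥ A k l *ᵥ d l) ≤
      δ * (opNormInf G * ∑ k, ∑ i, d k i ^ 2) := by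
    rw [hsum]
    refine (Finset.sum_le_sum fun k _ => Finset.sum_le_sum fun l _ => hterm k l).trans ?_
    simp only [← Finset.mul_sum]
    rw [hsplit]
    exact mul_le_mul_of_nonneg_left hfin hδ0
  rw [hS]
  linarith

/-- The game operator `T log x - r(x)` is strongly monotone on positive joint strategies once
the exploration rates dominate the interaction bound `c`. -/
lemma strongly_monotone_log_sub_reward (G : Matrix (Fin N) (Fin N) ℝ)
    (A : Fin N → Fin N → Matrix (Fin n) (Fin n) ℝ) (T : Fin N → ℝ) (hT : ∀ k, 0 < T k)
    {c m : ℝ} (hc : ∀ d : Fin N → Fin n → ℝ,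
      ∑ k, ∑ i, d k i * reward G A d k i ≤ c * ∑ k, ∑ i, d k i ^ 2)
    (hm : ∀ k, m ≤ T k - c) {x y : Fin N → Fin n → ℝ}
    (hx : ∀ k i, 0 < x k i ∧ x k i ≤ 1) (hy : ∀ k i, 0 < y k i ∧ y k i ≤ 1) :
    m * ∑ k, ∑ i, (x k i - y k i) ^ 2 ≤
      ∑ k, ∑ i, ((T k * Real.log (x k i) - reward G A x k i) -
        (T k * Real.log (y k i) - reward G A y k i)) * (x k i - y k i) := by
  have h1 := hc (x - y)
  simp only [reward_sub, Pi.sub_apply] at h1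
  have h2 : (m + c) * ∑ k, ∑ i, (x k i - y k i) ^ 2 ≤
      ∑ k, ∑ i, T k * ((Real.log (x k i) - Real.log (y k i)) * (x k i - y k i)) := by
    simp only [Finset.mul_sum]
    refine Finset.sum_le_sum fun k _ => Finset.sum_le_sum fun i _ => ?_
    exact (mul_le_mul_of_nonneg_right (by linarith [hm k]) (sq_nonneg _)).trans
      (mul_le_mul_of_nonneg_left (Real.sq_sub_le_log_sub_log_mul (hx k i).1 (hx k i).2
        (hy k i).1 (hy k i).2) (hT k).le)
  have h3 : ∑ k, ∑ i, ((T k * Real.log (x k i) - reward G A x k i) -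
        (T k * Real.log (y k i) - reward G A y k i)) * (x k i - y k i) =
      ∑ k, ∑ i, T k * ((Real.log (x k i) - Real.log (y k i)) * (x k i - y k i)) -
      ∑ k, ∑ i, (x k i - y k i) * (reward G A x k i - reward G A y k i) := by
    simp only [← Finset.sum_sub_distrib]
    refine Finset.sum_congr rfl fun k _ => Finset.sum_congr rfl fun i _ => ?_
    ring
  rw [h3]
  linarith

lemma le_one_of_sum_eq_one {v : Fin n → ℝ} (hs : ∑ i, v i = 1) (h0 : ∀ i, 0 ≤ v i)
    (i : Fin n) : v i ≤ 1 :=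
  hs ▸ Finset.single_le_sum (fun j _ => h0 j) (Finset.mem_univ i)

/-- Two Quantal Response Equilibria coincide. -/
lemma quantal_response_unique (hn : 0 < n) (G : Matrix (Fin N) (Fin N) ℝ)
    (A : Fin N → Fin N → Matrix (Fin n) (Fin n) ℝ) (T : Fin N → ℝ) (hT : ∀ k, 0 < T k)
    {c m : ℝ} (hc : ∀ d : Fin N → Fin n → ℝ,
      ∑ k, ∑ i, d k i * reward G A d k i ≤ c * ∑ k, ∑ i, d k i ^ 2)
    (hm0 : 0 < m) (hm : ∀ k, m ≤ T k - c) {x y : Fin N → Fin n → ℝ}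
    (hx : ∀ k, (∑ i, x k i) = 1 ∧ ∀ i, 0 ≤ x k i) (hy : ∀ k, (∑ i, y k i) = 1 ∧ ∀ i, 0 ≤ y k i)
    (hxq : ∀ k i, x k i = Real.exp (reward G A x k i / T k) /
      ∑ j, Real.exp (reward G A x k j / T k))
    (hyq : ∀ k i, y k i = Real.exp (reward G A y k i / T k) /
      ∑ j, Real.exp (reward G A y k j / T k)) : x = y := by
  have : Nonempty (Fin n) := ⟨⟨0, hn⟩⟩
  have hZ : ∀ (z : Fin N → Fin n → ℝ) k, 0 < ∑ j, Real.exp (reward G A z k j / T k) :=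
    fun z k => Finset.sum_pos (fun j _ => Real.exp_pos _) Finset.univ_nonempty
  have hlog : ∀ (z : Fin N → Fin n → ℝ), (∀ k i, z k i = Real.exp (reward G A z k i / T k) /
      ∑ j, Real.exp (reward G A z k j / T k)) → ∀ k i,
      0 < z k i ∧ T k * Real.log (z k i) - reward G A z k i =
        -(T k * Real.log (∑ j, Real.exp (reward G A z k j / T k))) := by
    intro z hz k i
    have hk := (hT k).ne'
    rw [hz k i]
    refine ⟨div_pos (Real.exp_pos _) (hZ z k), ?_⟩
    rw [Real.log_div (Real.exp_pos _).ne' (hZ z k).ne', Real.log_exp]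
    field_simp
    ring
  have hle := strongly_monotone_log_sub_reward G A T hT hc hm
    (fun k i => ⟨(hlog x hxq k i).1, le_one_of_sum_eq_one (hx k).1 (hx k).2 i⟩)
    (fun k i => ⟨(hlog y hyq k i).1, le_one_of_sum_eq_one (hy k).1 (hy k).2 i⟩)
  have h0 : ∑ k, ∑ i, ((T k * Real.log (x k i) - reward G A x k i) -
        (T k * Real.log (y k i) - reward G A y k i)) * (x k i - y k i) = 0 := by
    refine Finset.sum_eq_zero fun k _ => ?_
    simp only [(hlog x hxq k _).2, (hlog y hyq k _).2]
    rw [← Finset.mul_sum, Finset.sum_sub_distrib, (hx k).1, (hy k).1, sub_self, mul_zero]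
  rw [h0] at hle
  have hnn : ∀ k, 0 ≤ ∑ i, (x k i - y k i) ^ 2 := fun k =>
    Finset.sum_nonneg fun i _ => sq_nonneg _
  have hz : ∑ k, ∑ i, (x k i - y k i) ^ 2 = 0 :=
    le_antisymm (nonpos_of_mul_nonpos_right hle hm0) (Finset.sum_nonneg fun k _ => hnn k)
  ext k i
  have hk := (Finset.sum_eq_zero_iff_of_nonneg fun k _ => hnn k).1 hz k (Finset.mem_univ k)
  have hi := (Finset.sum_eq_zero_iff_of_nonneg fun i _ => sq_nonneg _).1 hk i (Finset.mem_univ i)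
  exact sub_eq_zero.1 (pow_eq_zero_iff two_ne_zero |>.1 hi)

/-- Joint strategies all of whose probabilities are at least `ε`. -/
def truncatedStrategies (N n : ℕ) (ε : ℝ) : Set (EuclideanSpace ℝ (Fin N × Fin n)) :=
  {x | (∀ k, ∑ i, x (k, i) = 1) ∧ ∀ p, ε ≤ x p}

lemma isClosed_truncatedStrategies (ε : ℝ) : IsClosed (truncatedStrategies N n ε) := by
  simp only [truncatedStrategies, Set.ofPred_and, Set.ofPred_forall]
  exact (isClosed_iInter fun k => isClosed_eq (by fun_prop) continuous_const).inter
    (isClosed_iInter fun p => isClosed_le continuous_const (by fun_prop))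

lemma convex_truncatedStrategies (ε : ℝ) : Convex ℝ (truncatedStrategies N n ε) := by
  rintro x ⟨hx, hx'⟩ y ⟨hy, hy'⟩ a b ha hb hab
  refine ⟨fun k => ?_, fun p => ?_⟩
  · simp [Finset.sum_add_distrib, ← Finset.mul_sum, hx, hy, hab]
  · have h1 := mul_le_mul_of_nonneg_left (hx' p) ha
    have h2 := mul_le_mul_of_nonneg_left (hy' p) hb
    have h3 : ε = a * ε + b * ε := by rw [← add_mul, hab, one_mul]
    simp only [PiLp.add_apply, PiLp.smul_apply, smul_eq_mul]
    linarith

/-- The game operator `T log x - r(x)`. -/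
noncomputable def gameOperator (G : Matrix (Fin N) (Fin N) ℝ)
    (A : Fin N → Fin N → Matrix (Fin n) (Fin n) ℝ) (T : Fin N → ℝ)
    (x : EuclideanSpace ℝ (Fin N × Fin n)) : EuclideanSpace ℝ (Fin N × Fin n) :=
  WithLp.toLp 2 fun p => T p.1 * Real.log (x p) - reward G A (fun k i => x (k, i)) p.1 p.2

lemma exists_lipschitz_gameOperator (G : Matrix (Fin N) (Fin N) ℝ)
    (A : Fin N → Fin N → Matrix (Fin n) (Fin n) ℝ) (T : Fin N → ℝ) (hT : ∀ k, 0 < T k)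
    {ε : ℝ} (hε : 0 < ε) :
    ∃ L : ℝ, 0 < L ∧ ∀ x ∈ truncatedStrategies N n ε, ∀ y ∈ truncatedStrategies N n ε,
      ‖gameOperator G A T x - gameOperator G A T y‖ ≤ L * ‖x - y‖ := by
  obtain ⟨B, hB0, hB⟩ := exists_abs_reward_le G A
  obtain ⟨S, hS⟩ := Finite.exists_le T
  set D := |S| * ε⁻¹ + B with hD
  have hD0 : 0 < D := by positivity
  refine ⟨Real.sqrt (Fintype.card (Fin N × Fin n) + 1) * D, by positivity,
    fun x hx y hy => ?_⟩
  have hcoord : ∀ p, |x p - y p| ≤ ‖x - y‖ := fun p => PiLp.norm_apply_le (x - y) p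
  have hp : ∀ p, ‖(gameOperator G A T x - gameOperator G A T y) p‖ ≤ D * ‖x - y‖ := by
    intro p
    have h1 := hB ((fun k i => x (k, i)) - fun k i => y (k, i)) ‖x - y‖
      (fun k i => hcoord (k, i)) p.1 p.2
    rw [reward_sub] at h1
    have h2 : |T p.1 * (Real.log (x p) - Real.log (y p))| ≤ |S| * (ε⁻¹ * ‖x - y‖) := by
      rw [abs_mul, abs_of_pos (hT p.1)]
      refine mul_le_mul ((hS p.1).trans (le_abs_self _)) ?_ (abs_nonneg _) (abs_nonneg _)
      exact (Real.abs_log_sub_log_le hε (hx.2 p) (hy.2 p)).trans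
        (mul_le_mul_of_nonneg_left (hcoord p) (by positivity))
    have e : (gameOperator G A T x - gameOperator G A T y) p =
        T p.1 * (Real.log (x p) - Real.log (y p)) -
        (reward G A (fun k i => x (k, i)) p.1 p.2 -
          reward G A (fun k i => y (k, i)) p.1 p.2) := by
      simp only [gameOperator, PiLp.sub_apply]
      ring
    rw [e, Real.norm_eq_abs]
    refine (abs_sub _ _).trans ?_
    rw [hD]
    linarith
  rw [EuclideanSpace.norm_eq, mul_assoc]
  calc _ ≤ Real.sqrt ((Fintype.card (Fin N × Fin n) + 1) * (D * ‖x - y‖) ^ 2) := by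
        refine Real.sqrt_le_sqrt ?_
        refine (Finset.sum_le_sum fun p _ =>
          pow_le_pow_left₀ (norm_nonneg _) (hp p) 2).trans ?_
        rw [Finset.sum_const, Finset.card_univ, nsmul_eq_mul]
        exact mul_le_mul_of_nonneg_right (by linarith) (sq_nonneg _)
    _ = _ := by
        rw [Real.sqrt_mul' _ (sq_nonneg _), Real.sqrt_sq (by positivity)]

/-- At a solution of the variational inequality, the game operator is minimal on the actions
whose probability exceeds the lower bound. -/
lemma gameOperator_le_of_variational (G : Matrix (Fin N) (Fin N) ℝ)
    (A : Fin N → Fin N → Matrix (Fin n) (Fin n) ℝ) (T : Fin N → ℝ)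
    {ε : ℝ} {x : EuclideanSpace ℝ (Fin N × Fin n)} (hx : x ∈ truncatedStrategies N n ε)
    (hvi : ∀ y ∈ truncatedStrategies N n ε, 0 ≤ inner ℝ (gameOperator G A T x) (y - x))
    {k : Fin N} {i j : Fin n} (hj : ε < x (k, j)) :
    gameOperator G A T x (k, j) ≤ gameOperator G A T x (k, i) := by
  set t := x (k, j) - ε with ht
  have ht0 : 0 < t := sub_pos.2 hj
  have h := hvi (x + t • (EuclideanSpace.single (k, i) 1 - EuclideanSpace.single (k, j) 1)) ?_
  · rw [add_sub_cancel_left, inner_smul_right, inner_sub_right,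
      EuclideanSpace.inner_single_right, EuclideanSpace.inner_single_right] at h
    simp only [conj_trivial, one_mul] at h
    linarith [nonneg_of_mul_nonneg_right h ht0]
  · refine ⟨fun l => ?_, fun p => ?_⟩
    · simp only [PiLp.add_apply, PiLp.smul_apply, PiLp.sub_apply, PiLp.single_apply,
        smul_eq_mul, Prod.mk.injEq, Finset.sum_add_distrib, hx.1 l, ← Finset.mul_sum,
        Finset.sum_sub_distrib]
      by_cases hl : l = k <;> simp [hl]
    · have h1 := hx.2 p
      simp only [PiLp.add_apply, PiLp.smul_apply, PiLp.sub_apply, PiLp.single_apply,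
        smul_eq_mul]
      by_cases hpj : p = (k, j)
      · subst hpj
        split_ifs <;> linarith
      · rw [if_neg hpj]
        split_ifs <;> linarith

lemma exists_quantal_response (hn : 0 < n) (G : Matrix (Fin N) (Fin N) ℝ)
    (A : Fin N → Fin N → Matrix (Fin n) (Fin n) ℝ) (T : Fin N → ℝ) (hT : ∀ k, 0 < T k)
    {c m : ℝ} (hc : ∀ d : Fin N → Fin n → ℝ,
      ∑ k, ∑ i, d k i * reward G A d k i ≤ c * ∑ k, ∑ i, d k i ^ 2)
    (hm0 : 0 < m) (hm : ∀ k, m ≤ T k - c) :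
    ∃ x : Fin N → Fin n → ℝ, (∀ k, (∑ i, x k i) = 1 ∧ ∀ i, 0 ≤ x k i) ∧
      ∀ k i, x k i = Real.exp (reward G A x k i / T k) /
        ∑ j, Real.exp (reward G A x k j / T k) := by
  have hn' : (0 : ℝ) < n := Nat.cast_pos.2 hn
  obtain ⟨B, hB0, hB⟩ := exists_abs_reward_le G A
  obtain ⟨s', hs'⟩ := Finite.exists_le fun k => 2 * B / T k
  set s := max s' 0 + 1 with hs
  have hs0 : 0 < s := by positivity
  have hsT : ∀ k, 2 * B < T k * s := by
    intro k
    have : 2 * B / T k < s := ((hs' k).trans (le_max_left _ _)).trans_lt (lt_add_one _)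
    rwa [div_lt_iff₀' (hT k)] at this
  set ε := (n : ℝ)⁻¹ * Real.exp (-s) with hε
  have hε0 : 0 < ε := by positivity
  have hεn : ε < (n : ℝ)⁻¹ :=
    mul_lt_of_lt_one_right (by positivity) (by simpa using hs0)
  have hbd : ∀ x ∈ truncatedStrategies N n ε, ∀ k i, 0 < x (k, i) ∧ x (k, i) ≤ 1 :=
    fun x hx k i => ⟨hε0.trans_le (hx.2 _), le_one_of_sum_eq_one (v := fun i => x (k, i))
      (hx.1 k) (fun i => hε0.le.trans (hx.2 _)) i⟩
  obtain ⟨L, hL0, hL⟩ := exists_lipschitz_gameOperator (n := n) G A T hT hε0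
  obtain ⟨x, hx, hvi⟩ := exists_variational_inequality_solution
    (K := truncatedStrategies N n ε)
    ⟨WithLp.toLp 2 fun _ => (n : ℝ)⁻¹, fun k => by simp [hn'.ne'], fun p => hεn.le⟩
    (isClosed_truncatedStrategies ε) (convex_truncatedStrategies ε) (gameOperator G A T)
    hm0 hL0 (fun x hx y hy => by
      have h := strongly_monotone_log_sub_reward G A T hT hc hm (hbd x hx) (hbd y hy)
      simpa [EuclideanSpace.norm_sq_eq, PiLp.inner_apply, Fintype.sum_prod_type, gameOperator,
        mul_comm] using h) hL
  have hle : ∀ {k i j}, ε < x (k, j) →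
      gameOperator G A T x (k, j) ≤ gameOperator G A T x (k, i) :=
    fun hj => gameOperator_le_of_variational G A T hx hvi hj
  have hr := hB (fun k i => x (k, i)) 1 fun k i => by
    rw [abs_of_pos (hbd x hx k i).1]; exact (hbd x hx k i).2
  have hint : ∀ k i, ε < x (k, i) := by
    intro k i
    by_contra hcon
    have hi : x (k, i) = ε := le_antisymm (not_lt.1 hcon) (hx.2 _)
    obtain ⟨j, -, hj⟩ : ∃ j ∈ Finset.univ, (n : ℝ)⁻¹ ≤ x (k, j) := by
      refine Finset.exists_le_of_sum_le ⟨i, Finset.mem_univ i⟩ ?_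
      rw [hx.1 k]
      simp [hn'.ne']
    have h := hle (i := i) (hεn.trans_le hj)
    simp only [gameOperator, hi] at h
    have hlj : -Real.log n ≤ Real.log (x (k, j)) := by
      rw [← Real.log_inv]
      exact Real.log_le_log (by positivity) hj
    have hlε : Real.log ε = -Real.log n - s := by
      rw [hε, Real.log_mul (by positivity) (Real.exp_pos _).ne', Real.log_inv, Real.log_exp]
      ring
    have h1 := mul_le_mul_of_nonneg_left hlj (hT k).le
    have h2 := abs_le.1 (hr k i)
    have h3 := abs_le.1 (hr k j)
    rw [hlε] at h
    nlinarith [hsT k]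
  refine ⟨fun k i => x (k, i), fun k => ⟨hx.1 k, fun i => (hbd x hx k i).1.le⟩, fun k i => ?_⟩
  set φ := gameOperator G A T x (k, i) with hφ
  have hexp : ∀ j, Real.exp (reward G A (fun k i => x (k, i)) k j / T k) =
      x (k, j) * Real.exp (-(φ / T k)) := by
    intro j
    have h : φ = gameOperator G A T x (k, j) := le_antisymm (hle (hint k i)) (hle (hint k j))
    have hk := (hT k).ne'
    rw [← Real.exp_log (hbd x hx k j).1, ← Real.exp_add, h]
    simp only [gameOperator]
    congr 1
    field_simp
    ring
  simp only [hexp]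
  rw [← Finset.sum_mul, hx.1 k, one_mul, mul_div_cancel_right₀ _ (Real.exp_pos _).ne']

end Game

/-- Uniqueness of the Quantal Response Equilibrium: in a network game with adjacency
matrix `G`, payoff matrices `A^{kl}`, rewards `r_k(x) = Σ_l G_{kl} A^{kl} x_l` and
exploration rates `T_k > (1/2) δ_S ‖G‖∞`, there is exactly one joint strategy
`x̄ ∈ (Δⁿ)^N` with `x̄_{ki} = exp(r_{ki}(x̄)/T_k)/Σ_j exp(r_{kj}(x̄)/T_k)` for all `k, i`. -/
theorem stmt13 {N n : ℕ} (hn : 0 < n)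
    (G : Matrix (Fin N) (Fin N) ℝ) (hGsym : G.IsSymm)
    (hG01 : ∀ k l, G k l = 0 ∨ G k l = 1) (hGdiag : ∀ k, G k k = 0)
    (A : Fin N → Fin N → Matrix (Fin n) (Fin n) ℝ)
    (T : Fin N → ℝ) (hT : ∀ k, 0 < T k)
    (δS : ℝ)
    (hδS : δS = ⨆ p : {q : Fin N × Fin N // G q.1 q.2 = 1},
      opNorm2 (A p.1.1 p.1.2 + (A p.1.2 p.1.1)ᵀ))
    (hTbig : ∀ k, (1 / 2) * δS * opNormInf G < T k) :
    ∃! xb : Fin N → Fin n → ℝ,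
      (∀ k, (∑ i, xb k i) = 1 ∧ ∀ i, 0 ≤ xb k i) ∧
      ∀ k i, xb k i =
        Real.exp ((∑ l, G k l * (A k l).mulVec (xb l) i) / T k) /
          ∑ j, Real.exp ((∑ l, G k l * (A k l).mulVec (xb l) j) / T k) := by
  have hc := fun d => sum_mul_reward_le G hGsym hG01 A d
  rw [← hδS] at hc
  obtain ⟨m, hm0, hm⟩ : ∃ m : ℝ, 0 < m ∧ ∀ k, m ≤ T k - 1 / 2 * δS * opNormInf G := by
    rcases isEmpty_or_nonempty (Fin N) with h | h
    · exact ⟨1, one_pos, fun k => h.elim k⟩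
    · obtain ⟨k, hk⟩ := Finite.exists_min fun k => T k - 1 / 2 * δS * opNormInf G
      exact ⟨_, sub_pos.2 (hTbig k), hk⟩
  obtain ⟨x, hx, hxq⟩ := exists_quantal_response hn G A T hT hc hm0 hm
  exact ⟨x, ⟨hx, hxq⟩, fun y hy =>
    quantal_response_unique hn G A T hT hc hm0 hm hy.1 hx hy.2 hxq⟩
end

section
/- (Pairwise zero-sum case, Corollary 1, equilibrium form) Consider a network game with N agents on a symmetric adjacency matrix G ∈ {0,1}^{N×N} with zero diagonal, n actions per agent, and payoff matrices A^{kl} satisfying the pairwise zero-sum condition A^{kl} + (A^{lk})ᵀ = 0 for every edge (k,l) with G_{kl}=1. Then for any exploration rates T_1,…,T_N > 0: (i) the entropy-perturbed pseudo-gradient F, with blocks F_k(x) = −Σ_l G_{kl} A^{kl} x_l + T_k(ln x_k + 𝟙), is strongly monotone with constant min_k T_k on the product of relative interiors of the simplices; and (ii) the game has a unique Quantal Response Equilibrium. -/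
open scoped BigOperators
open Matrix

/-- The Gibbs (softmax) distribution with energies `a`. -/
noncomputable def softmax {κ : Type*} [Fintype κ] (a : κ → ℝ) (i : κ) : ℝ :=
  Real.exp (a i) / ∑ j, Real.exp (a j)

section Softmax

variable {κ : Type*} [Fintype κ]

lemma sum_exp_pos [Nonempty κ] (a : κ → ℝ) : 0 < ∑ j, Real.exp (a j) :=
  Finset.sum_pos (fun _ _ => Real.exp_pos _) Finset.univ_nonempty

lemma softmax_pos [Nonempty κ] (a : κ → ℝ) (i : κ) : 0 < softmax a i :=
  div_pos (Real.exp_pos _) (sum_exp_pos a)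

lemma sum_softmax [Nonempty κ] (a : κ → ℝ) : ∑ i, softmax a i = 1 := by
  simp only [softmax, ← Finset.sum_div]
  exact div_self (sum_exp_pos a).ne'

lemma log_softmax [Nonempty κ] (a : κ → ℝ) (i : κ) :
    Real.log (softmax a i) = a i - Real.log (∑ j, Real.exp (a j)) := by
  rw [softmax, Real.log_div (Real.exp_pos _).ne' (sum_exp_pos a).ne', Real.log_exp]

lemma softmax_mem_stdSimplex [Nonempty κ] (a : κ → ℝ) : softmax a ∈ stdSimplex ℝ κ :=
  ⟨fun i => (softmax_pos a i).le, sum_softmax a⟩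

lemma log_sub_log_mul_sub_ge {x y : ℝ} (hx : 0 < x) (hy : 0 < y) (hx1 : x ≤ 1) (hy1 : y ≤ 1) :
    (x - y) ^ 2 ≤ (Real.log x - Real.log y) * (x - y) := by
  wlog h : y ≤ x generalizing x y
  · have := this hy hx hy1 hx1 (le_of_not_ge h)
    nlinarith
  have h1 := Real.log_le_sub_one_of_pos (div_pos hy hx)
  rw [Real.log_div hy.ne' hx.ne'] at h1
  have h2 : x - y ≤ 1 - y / x := by
    rw [one_sub_div hx.ne', le_div_iff₀ hx]
    nlinarith
  nlinarith

/-- Pointwise form of Gibbs' inequality. -/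
lemma mul_log_sub_mul_log_sub_add_nonneg {x y : ℝ} (hx : 0 ≤ x) (hy : 0 < y) :
    0 ≤ x * Real.log x - x * Real.log y - x + y := by
  rcases hx.eq_or_lt with rfl | hx
  · simpa using hy.le
  have h := Real.log_le_sub_one_of_pos (div_pos hy hx)
  rw [Real.log_div hy.ne' hx.ne'] at h
  have h2 := mul_le_mul_of_nonneg_left h hx.le
  have h3 : x * (y / x - 1) = y - x := by field_simp
  linarith

lemma eq_of_mul_log_sub_mul_log_sub_add_eq_zero {x y : ℝ} (hx : 0 ≤ x) (hy : 0 < y)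
    (h0 : x * Real.log x - x * Real.log y - x + y = 0) : x = y := by
  rcases hx.eq_or_lt with rfl | hx
  · simp at h0
    exact h0.symm
  by_contra hne
  have hne' : y / x ≠ 1 := by
    intro h
    exact hne ((div_eq_one_iff_eq hx.ne').1 h).symm
  have h := Real.log_lt_sub_one_of_pos (div_pos hy hx) hne'
  rw [Real.log_div hy.ne' hx.ne'] at h
  have h2 := mul_lt_mul_of_pos_left h hx
  have h3 : x * (y / x - 1) = y - x := by field_simp
  linarith

/-- The Fenchel–Young gap of log-sum-exp is the relative entropy to the softmax. -/
lemma fenchelYoung_eq_sum [Nonempty κ] (a : κ → ℝ) {p : κ → ℝ} (hp : p ∈ stdSimplex ℝ κ) :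
    Real.log (∑ j, Real.exp (a j)) + ∑ i, p i * Real.log (p i) - ∑ i, p i * a i =
      ∑ i, (p i * Real.log (p i) - p i * Real.log (softmax a i) - p i + softmax a i) := by
  simp only [log_softmax, mul_sub, Finset.sum_add_distrib, Finset.sum_sub_distrib,
    ← Finset.sum_mul, hp.2, sum_softmax]
  ring

lemma fenchelYoung_nonneg [Nonempty κ] (a : κ → ℝ) {p : κ → ℝ} (hp : p ∈ stdSimplex ℝ κ) :
    0 ≤ Real.log (∑ j, Real.exp (a j)) + ∑ i, p i * Real.log (p i) - ∑ i, p i * a i := by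
  rw [fenchelYoung_eq_sum a hp]
  exact Finset.sum_nonneg fun i _ =>
    mul_log_sub_mul_log_sub_add_nonneg (hp.1 i) (softmax_pos a i)

lemma eq_softmax_of_fenchelYoung_eq_zero [Nonempty κ] (a : κ → ℝ) {p : κ → ℝ}
    (hp : p ∈ stdSimplex ℝ κ)
    (h : Real.log (∑ j, Real.exp (a j)) + ∑ i, p i * Real.log (p i) - ∑ i, p i * a i = 0) :
    p = softmax a := by
  rw [fenchelYoung_eq_sum a hp, Finset.sum_eq_zero_iff_of_nonneg fun i _ =>
    mul_log_sub_mul_log_sub_add_nonneg (hp.1 i) (softmax_pos a i)] at h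
  funext i
  exact eq_of_mul_log_sub_mul_log_sub_add_eq_zero (hp.1 i) (softmax_pos a i)
    (h i (Finset.mem_univ i))

lemma fenchelYoung_softmax [Nonempty κ] (a : κ → ℝ) :
    Real.log (∑ j, Real.exp (a j)) + ∑ i, softmax a i * Real.log (softmax a i) =
      ∑ i, softmax a i * a i := by
  simp only [log_softmax, mul_sub, Finset.sum_sub_distrib, ← Finset.sum_mul, sum_softmax]
  ring

lemma hasDerivAt_log_sum_exp [Nonempty κ] (a b : κ → ℝ) :
    HasDerivAt (fun t : ℝ => Real.log (∑ j, Real.exp (a j + t * b j)))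
      (∑ j, softmax a j * b j) 0 := by
  have h1 : HasDerivAt (fun t : ℝ => ∑ j, Real.exp (a j + t * b j))
      (∑ j, Real.exp (a j) * b j) 0 := by
    refine HasDerivAt.fun_sum fun j _ => ?_
    have h := (((hasDerivAt_id (0 : ℝ)).mul_const (b j)).const_add (a j)).exp
    simpa using h
  have h2 := h1.log (by simpa using (sum_exp_pos a).ne')
  convert h2 using 1
  simp only [softmax, Finset.sum_div, zero_mul, add_zero]
  exact Finset.sum_congr rfl fun j _ => by ring

end Softmax

lemma nonneg_of_hasDerivAt_of_isMin_right {g : ℝ → ℝ} {d : ℝ} (hg : HasDerivAt g d 0)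
    (hmin : ∀ t, 0 ≤ t → t ≤ 1 → g 0 ≤ g t) : 0 ≤ d := by
  have h := hg.hasDerivWithinAt (s := Set.Ioi 0)
  rw [hasDerivWithinAt_iff_tendsto_slope' (by simp)] at h
  refine ge_of_tendsto h ?_
  filter_upwards [Ioc_mem_nhdsGT (zero_lt_one' ℝ)] with t ht
  rw [slope_def_field]
  exact div_nonneg (sub_nonneg.2 (hmin t ht.1.le ht.2)) (by linarith [ht.1])

/-- Existence of a logit equilibrium for a skew-symmetric linear reward map. The equilibrium is
obtained by minimizing the total Fenchel–Young gap over the product of simplices. -/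
lemma exists_softmax_fixedPoint {ι κ : Type*} [Fintype ι] [Fintype κ] [Nonempty κ]
    (R : (ι → κ → ℝ) →ₗ[ℝ] (ι → κ → ℝ)) (hR : ∀ u, ∑ k, ∑ i, u k i * R u k i = 0)
    (T : ι → ℝ) (hT : ∀ k, 0 < T k) :
    ∃ x : ι → κ → ℝ, (∀ k, x k ∈ stdSimplex ℝ κ) ∧
      ∀ k, x k = softmax (fun i => R x k i / T k) := by
  let L : (ι → κ → ℝ) → ι → ℝ := fun x k => Real.log (∑ j, Real.exp (R x k j / T k))
  let h : (ι → κ → ℝ) → ι → ℝ := fun x k => ∑ i, x k i * Real.log (x k i)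
  have hRc : Continuous R := R.continuous_of_finiteDimensional
  have hcont : Continuous fun x => ∑ k, T k * (L x k + h x k) := by
    refine continuous_finsetSum _ fun k _ => continuous_const.mul (Continuous.add ?_ ?_)
    · refine Continuous.log ?_ fun x => (sum_exp_pos _).ne'
      refine continuous_finsetSum _ fun j _ => Real.continuous_exp.comp ?_
      exact ((continuous_apply_apply k j).comp hRc).div_const _
    · exact continuous_finsetSum _ fun i _ =>
        Real.continuous_mul_log.comp (continuous_apply_apply k i)
  have hcomp : IsCompact (Set.univ.pi fun _ : ι => stdSimplex ℝ κ) :=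
    isCompact_univ_pi fun _ => isCompact_stdSimplex ℝ κ
  obtain ⟨x, hx, hmin⟩ := hcomp.exists_isMinOn
    ⟨fun _ => softmax 0, fun _ _ => softmax_mem_stdSimplex 0⟩ hcont.continuousOn
  have hx' : ∀ k, x k ∈ stdSimplex ℝ κ := fun k => hx k trivial
  refine ⟨x, hx', ?_⟩
  let y : ι → κ → ℝ := fun k => softmax fun i => R x k i / T k
  have hy' : ∀ k, y k ∈ stdSimplex ℝ κ := fun k => softmax_mem_stdSimplex _
  have hzero : ∀ u : ι → κ → ℝ, ∑ k, T k * ∑ i, u k i * (R u k i / T k) = 0 := by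
    intro u
    rw [← hR u]
    refine Finset.sum_congr rfl fun k _ => ?_
    rw [Finset.mul_sum]
    refine Finset.sum_congr rfl fun i _ => ?_
    have := (hT k).ne'
    field_simp
  have hxy : ∀ k, L x k + h y k = ∑ i, y k i * (R x k i / T k) := fun k =>
    fenchelYoung_softmax _
  have hder : HasDerivAt (fun t : ℝ => ∑ k, T k * (Real.log (∑ j, Real.exp (R x k j / T k +
      t * ((R y k j - R x k j) / T k))) + ((1 - t) * h x k + t * h y k)))
      (∑ k, T k * (∑ j, y k j * ((R y k j - R x k j) / T k) + (h y k - h x k))) 0 := by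
    refine HasDerivAt.fun_sum fun k _ => HasDerivAt.const_mul _ (HasDerivAt.add ?_ ?_)
    · exact hasDerivAt_log_sum_exp _ _
    · have h1 := (((hasDerivAt_id (0 : ℝ)).const_sub 1).mul_const (h x k)).add
        ((hasDerivAt_id (0 : ℝ)).mul_const (h y k))
      exact h1.congr_deriv (by ring)
  have hd := nonneg_of_hasDerivAt_of_isMin_right hder (by
    intro t ht0 ht1
    have hz : (fun k => (1 - t) • x k + t • y k) ∈ Set.univ.pi fun _ : ι => stdSimplex ℝ κ :=
      fun k _ => convex_stdSimplex ℝ κ (hx' k) (hy' k) (by linarith) ht0 (by ring)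
    have hle := isMinOn_iff.1 hmin _ hz
    have hRz : R (fun k => (1 - t) • x k + t • y k) = (1 - t) • R x + t • R y := by
      rw [← map_smul, ← map_smul, ← map_add]
      rfl
    calc _ = ∑ k, T k * (L x k + h x k) := by simp [L]
      _ ≤ _ := hle
      _ ≤ _ := by
        refine Finset.sum_le_sum fun k _ => mul_le_mul_of_nonneg_left ?_ (hT k).le
        refine add_le_add (le_of_eq ?_) ?_
        · simp only [L, hRz]
          congr 1
          refine Finset.sum_congr rfl fun j _ => ?_
          congr 1
          simp only [Pi.add_apply, Pi.smul_apply, smul_eq_mul]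
          ring
        · simp only [h, Finset.mul_sum, ← Finset.sum_add_distrib]
          refine Finset.sum_le_sum fun i _ => ?_
          exact Real.convexOn_mul_log.2 ((hx' k).1 i) ((hy' k).1 i) (by linarith) ht0 (by ring))
  have hsum : ∑ k, T k * (∑ j, y k j * ((R y k j - R x k j) / T k) + (h y k - h x k)) =
      - ∑ k, T k * (L x k + h x k - ∑ i, x k i * (R x k i / T k)) := by
    have hy0 := hzero y
    have hx0 := hzero x
    have : ∀ k, T k * (∑ j, y k j * ((R y k j - R x k j) / T k) + (h y k - h x k)) =
        T k * ∑ j, y k j * (R y k j / T k) - T k * ∑ i, x k i * (R x k i / T k)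
         - T k * (L x k + h x k - ∑ i, x k i * (R x k i / T k)) := by
      intro k
      simp only [sub_div, mul_sub, Finset.sum_sub_distrib]
      rw [← hxy k]
      ring
    simp only [this, Finset.sum_sub_distrib]
    rw [hy0, hx0]
    ring
  have hnn : ∀ k ∈ Finset.univ, 0 ≤ T k * (L x k + h x k - ∑ i, x k i * (R x k i / T k)) :=
    fun k _ => mul_nonneg (hT k).le (fenchelYoung_nonneg _ (hx' k))
  have hall := (Finset.sum_eq_zero_iff_of_nonneg hnn).1
    (le_antisymm (by linarith) (Finset.sum_nonneg hnn))
  intro k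
  refine eq_softmax_of_fenchelYoung_eq_zero _ (hx' k) ?_
  exact (mul_eq_zero.1 (hall k (Finset.mem_univ k))).resolve_left (hT k).ne'

/-- The reward map `x ↦ (r_k(x))_k` of a network game. -/
def networkReward {ι κ : Type*} [Fintype ι] [Fintype κ] (G : Matrix ι ι ℝ)
    (A : ι → ι → Matrix κ κ ℝ) : (ι → κ → ℝ) →ₗ[ℝ] (ι → κ → ℝ) where
  toFun x k i := ∑ l, G k l * (A k l).mulVec (x l) i
  map_add' x y := by
    funext k i
    simp [Matrix.mulVec_add, mul_add, Finset.sum_add_distrib]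
  map_smul' c x := by
    funext k i
    simp [Matrix.mulVec_smul, Finset.mul_sum, mul_left_comm]

lemma sum_mul_networkReward_eq_zero {ι κ : Type*} [Fintype ι] [Fintype κ] (G : Matrix ι ι ℝ)
    (hGsym : G.IsSymm) (hG01 : ∀ k l, G k l = 0 ∨ G k l = 1) (A : ι → ι → Matrix κ κ ℝ)
    (hzs : ∀ k l, G k l = 1 → A k l + (A l k)ᵀ = 0) (u : ι → κ → ℝ) :
    ∑ k, ∑ i, u k i * networkReward G A u k i = 0 := by
  have h1 : ∑ k, ∑ i, u k i * networkReward G A u k i =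
      ∑ k, ∑ l, G k l * (u k ⬝ᵥ (A k l *ᵥ u l)) := by
    refine Finset.sum_congr rfl fun k _ => ?_
    simp only [networkReward, LinearMap.coe_mk, AddHom.coe_mk, dotProduct, Finset.mul_sum]
    rw [Finset.sum_comm]
    exact Finset.sum_congr rfl fun l _ => Finset.sum_congr rfl fun i _ => by ring
  have hskew : ∀ k l, G k l * (u k ⬝ᵥ (A k l *ᵥ u l)) = -(G l k * (u l ⬝ᵥ (A l k *ᵥ u k))) := by
    intro k l
    rw [hGsym.apply k l]
    rcases hG01 k l with h | h
    · simp [h]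
    · rw [eq_neg_of_add_eq_zero_left (hzs k l h), Matrix.neg_mulVec, dotProduct_neg,
        Matrix.mulVec_transpose, dotProduct_comm, ← Matrix.dotProduct_mulVec]
      ring
  have h2 : ∑ k, ∑ l, G k l * (u k ⬝ᵥ (A k l *ᵥ u l)) =
      -∑ k, ∑ l, G k l * (u k ⬝ᵥ (A k l *ᵥ u l)) := by
    conv_lhs => rw [Finset.sum_comm]
    simp only [← Finset.sum_neg_distrib]
    exact Finset.sum_congr rfl fun k _ => Finset.sum_congr rfl fun l _ => hskew l k
  linarith

/-- Strong monotonicity of the entropy-perturbed pseudo-gradient, in weighted form. -/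
lemma sum_weighted_sq_le_pseudoGradient {ι κ : Type*} [Fintype ι] [Fintype κ]
    (R : (ι → κ → ℝ) →ₗ[ℝ] (ι → κ → ℝ)) (hR : ∀ u, ∑ k, ∑ i, u k i * R u k i = 0)
    (T : ι → ℝ) (hT : ∀ k, 0 < T k) {x y : ι → κ → ℝ}
    (hx : ∀ k, (∑ i, x k i) = 1 ∧ ∀ i, 0 < x k i) (hy : ∀ k, (∑ i, y k i) = 1 ∧ ∀ i, 0 < y k i) :
    ∑ k, T k * ∑ i, (x k i - y k i) ^ 2 ≤
      ∑ k, ∑ i, ((-R x k i + T k * (Real.log (x k i) + 1)) -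
        (-R y k i + T k * (Real.log (y k i) + 1))) * (x k i - y k i) := by
  have hle : ∀ z : ι → κ → ℝ, (∀ k, (∑ i, z k i) = 1 ∧ ∀ i, 0 < z k i) → ∀ k i, z k i ≤ 1 := by
    intro z hz k i
    rw [← (hz k).1]
    exact Finset.single_le_sum (fun j _ => ((hz k).2 j).le) (Finset.mem_univ i)
  have h0 := hR (x - y)
  calc _ ≤ ∑ k, T k * ∑ i, (Real.log (x k i) - Real.log (y k i)) * (x k i - y k i) :=
        Finset.sum_le_sum fun k _ => mul_le_mul_of_nonneg_left
          (Finset.sum_le_sum fun i _ => log_sub_log_mul_sub_ge ((hx k).2 i) ((hy k).2 i)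
            (hle x hx k i) (hle y hy k i)) (hT k).le
    _ = ∑ k, T k * ∑ i, (Real.log (x k i) - Real.log (y k i)) * (x k i - y k i) -
          ∑ k, ∑ i, (x - y) k i * R (x - y) k i := by rw [h0, sub_zero]
    _ = _ := by
      rw [← Finset.sum_sub_distrib]
      refine Finset.sum_congr rfl fun k _ => ?_
      rw [Finset.mul_sum, ← Finset.sum_sub_distrib]
      refine Finset.sum_congr rfl fun i _ => ?_
      simp only [map_sub, Pi.sub_apply]
      ring

lemma softmax_fixedPoint_unique {ι κ : Type*} [Fintype ι] [Fintype κ] [Nonempty κ]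
    (R : (ι → κ → ℝ) →ₗ[ℝ] (ι → κ → ℝ)) (hR : ∀ u, ∑ k, ∑ i, u k i * R u k i = 0)
    (T : ι → ℝ) (hT : ∀ k, 0 < T k) {x y : ι → κ → ℝ}
    (hx : ∀ k, x k = softmax (fun i => R x k i / T k))
    (hy : ∀ k, y k = softmax (fun i => R y k i / T k)) : x = y := by
  have hpos : ∀ z : ι → κ → ℝ, (∀ k, z k = softmax (fun i => R z k i / T k)) →
      ∀ k, (∑ i, z k i) = 1 ∧ ∀ i, 0 < z k i := by
    intro z hz k
    rw [hz k]
    exact ⟨sum_softmax _, softmax_pos _⟩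
  have hF : ∀ z : ι → κ → ℝ, (∀ k, z k = softmax (fun i => R z k i / T k)) → ∀ k i,
      -R z k i + T k * (Real.log (z k i) + 1) =
        T k * (1 - Real.log (∑ j, Real.exp (R z k j / T k))) := by
    intro z hz k i
    rw [congrFun (hz k) i, log_softmax]
    have := (hT k).ne'
    field_simp
    ring
  have hmono := sum_weighted_sq_le_pseudoGradient R hR T hT (hpos x hx) (hpos y hy)
  simp only [hF x hx, hF y hy, ← Finset.mul_sum, Finset.sum_sub_distrib, (hpos x hx _).1,
    (hpos y hy _).1, sub_self, mul_zero, Finset.sum_const_zero] at hmono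
  have hnn : ∀ k ∈ Finset.univ, 0 ≤ T k * ∑ i, (x k i - y k i) ^ 2 := fun k _ =>
    mul_nonneg (hT k).le (Finset.sum_nonneg fun i _ => sq_nonneg _)
  have hall := (Finset.sum_eq_zero_iff_of_nonneg hnn).1 (le_antisymm hmono (Finset.sum_nonneg hnn))
  funext k i
  have hk := (mul_eq_zero.1 (hall k (Finset.mem_univ k))).resolve_left (hT k).ne'
  rw [Finset.sum_eq_zero_iff_of_nonneg fun i _ => sq_nonneg _] at hk
  exact sub_eq_zero.1 (pow_eq_zero_iff two_ne_zero |>.1 (hk i (Finset.mem_univ i)))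

/-- Pairwise zero-sum network games (Corollary 1): if `A^{kl} + (A^{lk})ᵀ = 0` on every
edge, then for any positive exploration rates the entropy-perturbed pseudo-gradient is
strongly monotone with constant `min_k T_k` on the product of relative interiors of the
simplices, and the game has a unique Quantal Response Equilibrium. -/
theorem stmt14 {N n : ℕ} (hn : 0 < n)
    (G : Matrix (Fin N) (Fin N) ℝ) (hGsym : G.IsSymm)
    (hG01 : ∀ k l, G k l = 0 ∨ G k l = 1) (hGdiag : ∀ k, G k k = 0)
    (A : Fin N → Fin N → Matrix (Fin n) (Fin n) ℝ)
    (hzs : ∀ k l, G k l = 1 → A k l + (A l k)ᵀ = 0)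
    (T : Fin N → ℝ) (hT : ∀ k, 0 < T k)
    (F : (Fin N → Fin n → ℝ) → Fin N → Fin n → ℝ)
    (hF : ∀ x k i, F x k i =
      -(∑ l, G k l * (A k l).mulVec (x l) i) + T k * (Real.log (x k i) + 1)) :
    (∀ x y : Fin N → Fin n → ℝ,
        (∀ k, (∑ i, x k i) = 1 ∧ ∀ i, 0 < x k i) →
        (∀ k, (∑ i, y k i) = 1 ∧ ∀ i, 0 < y k i) →
        (⨅ k, T k) * ∑ k, ∑ i, (x k i - y k i) ^ 2 ≤
          ∑ k, ∑ i, (F x k i - F y k i) * (x k i - y k i)) ∧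
    ∃! xb : Fin N → Fin n → ℝ,
      (∀ k, (∑ i, xb k i) = 1 ∧ ∀ i, 0 ≤ xb k i) ∧
      ∀ k i, xb k i =
        Real.exp ((∑ l, G k l * (A k l).mulVec (xb l) i) / T k) /
          ∑ j, Real.exp ((∑ l, G k l * (A k l).mulVec (xb l) j) / T k) := by
  have : Nonempty (Fin n) := ⟨⟨0, hn⟩⟩
  have hR := sum_mul_networkReward_eq_zero G hGsym hG01 A hzs
  refine ⟨fun x y hx hy => ?_, ?_⟩
  · have h := sum_weighted_sq_le_pseudoGradient _ hR T hT hx hy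
    simp only [hF]
    refine le_trans ?_ h
    rw [Finset.mul_sum]
    exact Finset.sum_le_sum fun k _ => mul_le_mul_of_nonneg_right
      (ciInf_le (Set.finite_range T).bddBelow k) (Finset.sum_nonneg fun i _ => sq_nonneg _)
  · obtain ⟨x, hx, hfix⟩ := exists_softmax_fixedPoint _ hR T hT
    refine ⟨x, ⟨fun k => ⟨(hx k).2, (hx k).1⟩, fun k i => congrFun (hfix k) i⟩, ?_⟩
    rintro y ⟨-, hy⟩
    exact softmax_fixedPoint_unique _ hR T hT (fun k => funext (hy k)) hfix
end
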